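/- arXiv:0811.1069 — 4 statements merged into one kernel-verified Lean document; each statement's English description precedes it below -/
import Mathlib

section
/- A monomial x^α y^β ∏_{u=1}^ℓ t_u^{c_u} of B belongs to the subalgebra π(S) if and only if α + β = ∑_{u=1}^ℓ c_u σ_u. -/
open MvPolynomial

/-- The variable index set: `T (i, j)` for `1 ≤ i ≤ ℓ`, `1 ≤ j ≤ σ i + 1`
(0-indexed: `i : Fin ℓ`, `j : Fin (σ i + 1)`). -/
abbrev ScrollVar {ℓ : ℕ} (σ : Fin ℓ → ℕ) : Type := Σ i : Fin ℓ, Fin (σ i + 1)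

/-- The polynomial ring `S = k[T_{i,j}]`. -/
abbrev ScrollS (k : Type) [Field k] {ℓ : ℕ} (σ : Fin ℓ → ℕ) : Type :=
  MvPolynomial (ScrollVar σ) k

/-- The polynomial ring `B = k[x, y, t_1, ..., t_ℓ]`, with `x = X (inl 0)`,
`y = X (inl 1)`, `t_i = X (inr i)`. -/
abbrev ScrollB (k : Type) [Field k] (ℓ : ℕ) : Type := MvPolynomial (Fin 2 ⊕ Fin ℓ) k

/-- The `k`-algebra homomorphism `π : S → B`, `π(T_{i,j}) = x^{σ_i - j + 1} y^{j-1} t_i`. -/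
noncomputable def scrollPi (k : Type) [Field k] {ℓ : ℕ} (σ : Fin ℓ → ℕ) :
    ScrollS k σ →ₐ[k] ScrollB k ℓ :=
  aeval fun s : ScrollVar σ =>
    X (Sum.inl 0) ^ (σ s.1 - s.2.val) * X (Sum.inl 1) ^ s.2.val * X (Sum.inr s.1)

/-- Setting `x = y = Z`, `t_u = 1` agrees on the range of `scrollPi` with setting `x = y = 1`,
`t_u = Z ^ σ u`. -/
theorem aeval_eq_aeval_of_mem_range_scrollPi {k : Type} [Field k] {ℓ : ℕ} {σ : Fin ℓ → ℕ}
    {f : ScrollB k ℓ} (hf : f ∈ (scrollPi k σ).range) :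
    aeval (Sum.elim (fun _ => (Polynomial.X : Polynomial k)) fun _ => 1) f =
      aeval (Sum.elim (fun _ => (1 : Polynomial k)) fun u => Polynomial.X ^ σ u) f := by
  obtain ⟨p, rfl⟩ := hf
  have h : (aeval (Sum.elim (fun _ => (Polynomial.X : Polynomial k)) fun _ => 1)).comp
        (scrollPi k σ) =
      (aeval (Sum.elim (fun _ => (1 : Polynomial k)) fun u => Polynomial.X ^ σ u)).comp
        (scrollPi k σ) := by
    refine MvPolynomial.algHom_ext fun s => ?_
    have hs : s.2.val ≤ σ s.1 := Nat.lt_succ_iff.mp s.2.isLt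
    simp [scrollPi, ← pow_add, Nat.sub_add_cancel hs]
  exact DFunLike.congr_fun h p

theorem generator_mem_range_scrollPi (k : Type) [Field k] {ℓ : ℕ} {σ : Fin ℓ → ℕ} {a b : ℕ}
    {u : Fin ℓ} (h : a + b = σ u) :
    (X (Sum.inl 0) ^ a * X (Sum.inl 1) ^ b * X (Sum.inr u) : ScrollB k ℓ) ∈
      (scrollPi k σ).range := by
  refine ⟨X ⟨u, ⟨b, by omega⟩⟩, ?_⟩
  have ha : σ u - b = a := by omega
  simp [scrollPi, ha]

theorem pow_mul_pow_mul_pow_mem_range_scrollPi (k : Type) [Field k] {ℓ : ℕ} {σ : Fin ℓ → ℕ}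
    (u : Fin ℓ) (c : ℕ) {a b : ℕ} (h : a + b = c * σ u) :
    (X (Sum.inl 0) ^ a * X (Sum.inl 1) ^ b * X (Sum.inr u) ^ c : ScrollB k ℓ) ∈
      (scrollPi k σ).range := by
  induction c generalizing a b with
  | zero =>
    obtain ⟨rfl, rfl⟩ : a = 0 ∧ b = 0 := by simpa using h
    simp
  | succ c ih =>
    rw [add_one_mul] at h
    obtain ⟨a₁, a₂, b₁, b₂, rfl, rfl, h₁, h₂⟩ : ∃ a₁ a₂ b₁ b₂, a = a₁ + a₂ ∧ b = b₁ + b₂ ∧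
        a₁ + b₁ = c * σ u ∧ a₂ + b₂ = σ u :=
      ⟨min a (c * σ u), a - min a (c * σ u), c * σ u - min a (c * σ u),
        b - (c * σ u - min a (c * σ u)), by omega, by omega, by omega, by omega⟩
    convert mul_mem (ih h₁) (generator_mem_range_scrollPi k h₂) using 1
    ring

theorem pow_mul_pow_mul_prod_mem_range_scrollPi (k : Type) [Field k] {ℓ : ℕ} {σ : Fin ℓ → ℕ}
    (c : Fin ℓ → ℕ) (s : Finset (Fin ℓ)) {a b : ℕ} (h : a + b = ∑ u ∈ s, c u * σ u) :
    (X (Sum.inl 0) ^ a * X (Sum.inl 1) ^ b * ∏ u ∈ s, X (Sum.inr u) ^ c u : ScrollB k ℓ) ∈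
      (scrollPi k σ).range := by
  induction s using Finset.induction_on generalizing a b with
  | empty =>
    obtain ⟨rfl, rfl⟩ : a = 0 ∧ b = 0 := by simpa using h
    simp
  | insert v s hv ih =>
    rw [Finset.sum_insert hv] at h
    obtain ⟨a₁, a₂, b₁, b₂, rfl, rfl, h₁, h₂⟩ : ∃ a₁ a₂ b₁ b₂, a = a₁ + a₂ ∧ b = b₁ + b₂ ∧
        a₁ + b₁ = c v * σ v ∧ a₂ + b₂ = ∑ u ∈ s, c u * σ u :=
      ⟨min a (c v * σ v), a - min a (c v * σ v), c v * σ v - min a (c v * σ v),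
        b - (c v * σ v - min a (c v * σ v)), by omega, by omega, by omega, by omega⟩
    rw [Finset.prod_insert hv]
    convert mul_mem (pow_mul_pow_mul_pow_mem_range_scrollPi k v (c v) h₁) (ih h₂) using 1
    ring

/-- **Observation 1.7(d).** A monomial `x^α y^β ∏ t_u^{c_u}` of `B` belongs to `π(S)`
if and only if `α + β = ∑ c_u σ_u`. -/
theorem monomial_mem_range_scrollPi_iff (k : Type) [Field k] (ℓ : ℕ) (hℓ : 1 ≤ ℓ)
    (σ : Fin ℓ → ℕ) (hσ : Antitone σ) (hσ1 : ∀ i, 1 ≤ σ i)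
    (α β : ℕ) (c : Fin ℓ → ℕ) :
    (X (Sum.inl 0) ^ α * X (Sum.inl 1) ^ β * ∏ u : Fin ℓ, X (Sum.inr u) ^ c u
        ∈ (scrollPi k σ).range) ↔
      α + β = ∑ u : Fin ℓ, c u * σ u := by
  refine ⟨fun h => ?_, fun h => pow_mul_pow_mul_prod_mem_range_scrollPi k c Finset.univ h⟩
  have h' := aeval_eq_aeval_of_mem_range_scrollPi h
  simp only [map_mul, map_pow, map_prod, aeval_X, Sum.elim_inl, Sum.elim_inr, one_pow,
    Finset.prod_const_one, mul_one, one_mul, ← pow_add, ← pow_mul, Finset.prod_pow_eq_pow_sum]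
    at h'
  simpa [mul_comm] using congrArg Polynomial.natDegree h'
end

section
/- The subalgebra π(S) is a direct summand of B as a π(S)-module; a complementary summand is the π(S)-submodule of B generated by all monomials x^α y^β ∏_{u=1}^ℓ t_u^{c_u} with α + β ≠ ∑_{u=1}^ℓ c_u σ_u. -/
open MvPolynomial

/-- The weights on the variables of `B`: `1` on `x` and `y`, and `-σ i` on `t_i`. -/
def scrollWeight {ℓ : ℕ} (σ : Fin ℓ → ℕ) : Fin 2 ⊕ Fin ℓ → ℤ :=
  Sum.elim (fun _ => 1) fun i => -(σ i : ℤ)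

lemma scrollPi_X (k : Type) [Field k] {ℓ : ℕ} (σ : Fin ℓ → ℕ) (s : ScrollVar σ) :
    scrollPi k σ (X s) =
      X (Sum.inl 0) ^ (σ s.1 - s.2.val) * X (Sum.inl 1) ^ s.2.val * X (Sum.inr s.1) := by
  simp [scrollPi]

lemma scrollPi_isWeightedHomogeneous (k : Type) [Field k] {ℓ : ℕ} (σ : Fin ℓ → ℕ)
    (p : ScrollS k σ) : IsWeightedHomogeneous (scrollWeight σ) (scrollPi k σ p) 0 := by
  induction p using MvPolynomial.induction_on with
  | C a =>
    rw [← algebraMap_eq, AlgHom.commutes, algebraMap_eq]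
    exact isWeightedHomogeneous_C _ a
  | add p q hp hq => rw [map_add]; exact hp.add hq
  | mul_X p s hp =>
    rw [map_mul, scrollPi_X]
    have hx := (isWeightedHomogeneous_X k (scrollWeight σ) (Sum.inl 0)).pow (σ s.1 - s.2.val)
    have hy := (isWeightedHomogeneous_X k (scrollWeight σ) (Sum.inl 1)).pow s.2.val
    have ht := isWeightedHomogeneous_X k (scrollWeight σ) (Sum.inr s.1)
    convert hp.mul ((hx.mul hy).mul ht) using 1
    have := s.2.is_lt
    simp only [scrollWeight, Sum.elim_inl, Sum.elim_inr, nsmul_eq_mul]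
    omega

/-- The elements of `B` without a component of weight zero, as a module over the image of `π`. -/
def scrollOffDegree (k : Type) [Field k] {ℓ : ℕ} (σ : Fin ℓ → ℕ) :
    Submodule (scrollPi k σ).range (ScrollB k ℓ) where
  carrier := {p | ∀ d, Finsupp.weight (scrollWeight σ) d = 0 → coeff d p = 0}
  zero_mem' := fun _ _ => coeff_zero _
  add_mem' := fun hp hq d hd => by rw [coeff_add, hp d hd, hq d hd, add_zero]
  smul_mem' := by
    rintro ⟨_, q, rfl⟩ p hp d hd
    change coeff d (scrollPi k σ q * p) = 0
    classical
    rw [coeff_mul]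
    refine Finset.sum_eq_zero fun e he => ?_
    by_cases h : coeff e.1 (scrollPi k σ q) = 0
    · rw [h, zero_mul]
    · have h1 := scrollPi_isWeightedHomogeneous k σ q h
      rw [← Finset.HasAntidiagonal.mem_antidiagonal.mp he, map_add, h1, zero_add] at hd
      rw [hp _ hd, mul_zero]

lemma exists_split_of_add_eq_add {a b m n : ℕ} (h : a + b = m + n) :
    ∃ a₁ b₁ a₂ b₂, a = a₁ + a₂ ∧ b = b₁ + b₂ ∧ a₁ + b₁ = m ∧ a₂ + b₂ = n :=
  ⟨m - min b m, min b m, a - (m - min b m), b - min b m, by omega, by omega, by omega, by omega⟩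

lemma X_pow_mem_scrollPi_range (k : Type) [Field k] {ℓ : ℕ} (σ : Fin ℓ → ℕ) (u : Fin ℓ) (n : ℕ) :
    ∀ a b : ℕ, a + b = n * σ u →
      (X (Sum.inl 0) ^ a * X (Sum.inl 1) ^ b * X (Sum.inr u) ^ n : ScrollB k ℓ) ∈
        (scrollPi k σ).range := by
  induction n with
  | zero =>
    intro a b h
    obtain ⟨rfl, rfl⟩ : a = 0 ∧ b = 0 := by omega
    simp
  | succ n ih =>
    intro a b h
    rw [Nat.succ_mul] at h
    obtain ⟨a₁, b₁, a₂, b₂, rfl, rfl, h₁, h₂⟩ := exists_split_of_add_eq_add h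
    have hgen : (X (Sum.inl 0) ^ a₂ * X (Sum.inl 1) ^ b₂ * X (Sum.inr u) : ScrollB k ℓ) ∈
        (scrollPi k σ).range := by
      refine ⟨X ⟨u, ⟨b₂, by omega⟩⟩, ?_⟩
      have : σ u - b₂ = a₂ := by omega
      simp [scrollPi_X, this]
    convert mul_mem (ih a₁ b₁ h₁) hgen using 1
    ring

lemma prod_X_pow_mem_scrollPi_range (k : Type) [Field k] {ℓ : ℕ} (σ c : Fin ℓ → ℕ)
    (s : Finset (Fin ℓ)) : ∀ a b : ℕ, a + b = ∑ u ∈ s, c u * σ u →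
      (X (Sum.inl 0) ^ a * X (Sum.inl 1) ^ b * ∏ u ∈ s, X (Sum.inr u) ^ c u : ScrollB k ℓ) ∈
        (scrollPi k σ).range := by
  induction s using Finset.induction_on with
  | empty =>
    intro a b h
    rw [Finset.sum_empty] at h
    obtain ⟨rfl, rfl⟩ : a = 0 ∧ b = 0 := by omega
    simp
  | insert u s hu ih =>
    intro a b h
    rw [Finset.sum_insert hu] at h
    obtain ⟨a₁, b₁, a₂, b₂, rfl, rfl, h₁, h₂⟩ := exists_split_of_add_eq_add h
    rw [Finset.prod_insert hu]
    convert mul_mem (X_pow_mem_scrollPi_range k σ u (c u) a₁ b₁ h₁) (ih a₂ b₂ h₂) using 1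
    ring

lemma scrollB_monomial_one_eq (k : Type) [Field k] {ℓ : ℕ} (d : Fin 2 ⊕ Fin ℓ →₀ ℕ) :
    (monomial d 1 : ScrollB k ℓ) = X (Sum.inl 0) ^ d (Sum.inl 0) * X (Sum.inl 1) ^ d (Sum.inl 1) *
      ∏ u : Fin ℓ, X (Sum.inr u) ^ d (Sum.inr u) := by
  rw [monomial_eq, Finsupp.prod_fintype _ _ fun _ => pow_zero _]
  simp [Fintype.prod_sum_type, Fin.prod_univ_two]

lemma weight_scrollWeight {ℓ : ℕ} (σ : Fin ℓ → ℕ) (d : Fin 2 ⊕ Fin ℓ →₀ ℕ) :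
    Finsupp.weight (scrollWeight σ) d =
      ((d (Sum.inl 0) + d (Sum.inl 1) : ℕ) : ℤ) - (∑ u, d (Sum.inr u) * σ u : ℕ) := by
  rw [Finsupp.weight_apply, Finsupp.sum_fintype _ _ fun i => zero_smul ℕ (scrollWeight σ i)]
  simp [Fintype.sum_sum_type, Fin.sum_univ_two, scrollWeight, sub_eq_add_neg]

lemma span_le_scrollOffDegree (k : Type) [Field k] {ℓ : ℕ} (σ : Fin ℓ → ℕ) :
    Submodule.span (scrollPi k σ).range
      { p : ScrollB k ℓ | ∃ (α β : ℕ) (c : Fin ℓ → ℕ),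
        α + β ≠ ∑ u : Fin ℓ, c u * σ u ∧
        p = X (Sum.inl 0) ^ α * X (Sum.inl 1) ^ β * ∏ u : Fin ℓ, X (Sum.inr u) ^ c u } ≤
      scrollOffDegree k σ := by
  rw [Submodule.span_le]
  rintro _ ⟨α, β, c, h, rfl⟩ d hd
  have hm := scrollB_monomial_one_eq k
    (Finsupp.equivFunOnFinite.symm (Sum.elim ![α, β] c))
  simp only [Finsupp.equivFunOnFinite_symm_apply_apply, Sum.elim_inl, Sum.elim_inr,
    Matrix.cons_val_zero, Matrix.cons_val_one] at hm
  classical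
  rw [← hm, coeff_monomial, if_neg]
  rintro rfl
  rw [weight_scrollWeight] at hd
  simp only [Finsupp.equivFunOnFinite_symm_apply_apply, Sum.elim_inl, Sum.elim_inr,
    Matrix.cons_val_zero, Matrix.cons_val_one] at hd
  omega

/-- **Observation 1.7(e).** The subalgebra `π(S)` is a direct summand of `B` as a
`π(S)`-module; a complementary summand is the `π(S)`-submodule of `B` generated by all
monomials `x^α y^β ∏ t_u^{c_u}` with `α + β ≠ ∑ c_u σ_u`.  Here the copy of `π(S)`
inside `B` is the `π(S)`-submodule `1 = π(S)·1`. -/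
theorem scrollPi_range_isComplemented (k : Type) [Field k] (ℓ : ℕ) (hℓ : 1 ≤ ℓ)
    (σ : Fin ℓ → ℕ) (hσ : Antitone σ) (hσ1 : ∀ i, 1 ≤ σ i) :
    IsCompl (1 : Submodule (scrollPi k σ).range (ScrollB k ℓ))
      (Submodule.span (scrollPi k σ).range
        { p : ScrollB k ℓ | ∃ (α β : ℕ) (c : Fin ℓ → ℕ),
          α + β ≠ ∑ u : Fin ℓ, c u * σ u ∧
          p = X (Sum.inl 0) ^ α * X (Sum.inl 1) ^ β * ∏ u : Fin ℓ, X (Sum.inr u) ^ c u }) := by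
  constructor
  · rw [Submodule.disjoint_def]
    intro p hp hq
    obtain ⟨⟨_, q, rfl⟩, rfl⟩ := Submodule.mem_one.mp hp
    change scrollPi k σ q = 0
    ext d
    by_cases hd : Finsupp.weight (scrollWeight σ) d = 0
    · exact span_le_scrollOffDegree k σ hq d hd
    · exact (scrollPi_isWeightedHomogeneous k σ q).coeff_eq_zero d hd
  · rw [codisjoint_iff, eq_top_iff]
    rintro p -
    rw [p.as_sum]
    refine Submodule.sum_mem _ fun d _ => ?_
    have hsmul : monomial d (coeff d p) =
        algebraMap k (scrollPi k σ).range (coeff d p) • (monomial d 1 : ScrollB k ℓ) := by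
      rw [algebraMap_smul, smul_monomial, smul_eq_mul, mul_one]
    rw [hsmul]
    refine Submodule.smul_mem _ _ ?_
    rw [scrollB_monomial_one_eq]
    by_cases h : d (Sum.inl 0) + d (Sum.inl 1) = ∑ u, d (Sum.inr u) * σ u
    · exact Submodule.mem_sup_left (Submodule.mem_one.mpr
        ⟨⟨_, prod_X_pow_mem_scrollPi_range k σ _ _ _ _ h⟩, rfl⟩)
    · exact Submodule.mem_sup_right (Submodule.subset_span ⟨_, _, fun u => d (Sum.inr u), h, rfl⟩)
end

section
/- Let R be a standard graded Noetherian ring over a field with homogeneous maximal ideal 𝔪, let M be a nonzero finitely generated graded R-module, and let M = M_0 ⊇ M_1 ⊇ ... ⊇ M_s = 0 be a finite filtration by graded submodules with factors N_i = M_i/M_{i+1}. If reg N_0 ≥ reg N_i for every i, then reg M = reg N_0 and depth M ≤ dim N_0. -/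
/-!  Castelnuovo-Mumford regularity of a finitely generated graded module `M` over a
standard graded Noetherian ring `R` over a field, defined through the graded pieces of
the local cohomology modules `H^i_𝔪(M)`.  Local cohomology is realized as the direct
limit of the Koszul cohomology of the powers `x₁^t, …, x_m^t` of a family of degree-one
generators of the irrelevant maximal ideal `𝔪`; a graded piece `H^i_𝔪(M)_j` is nonzero
iff some degree-`j` Koszul `i`-cocycle (for some `t`) never becomes a coboundary in the
limit. -/

/-- The differential of the Koszul cochain complex on `x₁^t, …, x_m^t` with
coefficients in `M`.  A `p`-cochain is a function on `p`-element subsets of `Fin m`;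
the differential is the usual alternating sum. -/
def koszulD {R M : Type*} [CommRing R] [AddCommGroup M] [Module R M] {m : ℕ}
    (x : Fin m → R) (t : ℕ) (ω : Finset (Fin m) → M) : Finset (Fin m) → M :=
  fun G => ∑ i ∈ G, ((-1 : ℤ) ^ (G.filter (· < i)).card) • (x i ^ t • ω (G.erase i))

/-- `ω` is a Koszul `p`-cochain, homogeneous of internal degree `j` (for the grading
`ℳ` of `M`, each `x_l` having degree one, so each `x_l^t` degree `t`): it is supported
on `p`-element subsets, and its value on such a subset lies in the graded piece
`ℳ (j + t * p)` (the basis covector attached to a `p`-subset having degree `-t*p`). -/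
def koszulHomog {k0 M : Type*} [Semiring k0] [AddCommMonoid M] [Module k0 M] {m : ℕ}
    (ℳ : ℤ → Submodule k0 M) (t p : ℕ) (j : ℤ) (ω : Finset (Fin m) → M) : Prop :=
  ∀ G : Finset (Fin m),
    (G.card = p → ω G ∈ ℳ (j + (t : ℤ) * (G.card : ℤ))) ∧ (G.card ≠ p → ω G = 0)

/-- The transition map from the Koszul complex on the `x_l^t` to the one on the
`x_l^{t'}`, `t ≤ t'`. -/
def koszulTrans {R M : Type*} [CommRing R] [AddCommGroup M] [Module R M] {m : ℕ}
    (x : Fin m → R) (t t' : ℕ) (ω : Finset (Fin m) → M) : Finset (Fin m) → M :=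
  fun F => (∏ l ∈ F, x l) ^ (t' - t) • ω F

/-- The degree-`j` graded piece of the local cohomology module `H^i_𝔪(M)` is nonzero:
there are `t` and a homogeneous degree-`j` Koszul `i`-cocycle `ω` on `x₁^t, …, x_m^t`
whose image in the Koszul complex of every higher power is not a coboundary of a
homogeneous cochain. -/
def gradedLocalCohNE {k0 R M : Type*} [Semiring k0] [CommRing R] [AddCommGroup M]
    [Module R M] [Module k0 M] {m : ℕ} (x : Fin m → R) (ℳ : ℤ → Submodule k0 M)
    (i : ℕ) (j : ℤ) : Prop :=
  ∃ (t : ℕ) (ω : Finset (Fin m) → M),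
    koszulHomog ℳ t i j ω ∧ koszulD x t ω = 0 ∧
    ∀ t', t ≤ t' → ¬ ∃ η : Finset (Fin m) → M,
      koszulHomog ℳ t' (i - 1) j η ∧ koszulD x t' η = koszulTrans x t t' ω

/-- The Castelnuovo-Mumford regularity
`reg M = sup { n : H^i_𝔪(M)_{n-i} ≠ 0 for some i ≥ 0 }` (so `reg 0 = -∞ = ⊥`),
computed with respect to the degree-one generators `x` of `𝔪` and the grading `ℳ`
of `M`. -/
noncomputable def cmRegularity {k0 R M : Type*} [Semiring k0] [CommRing R]
    [AddCommGroup M] [Module R M] [Module k0 M] {m : ℕ} (x : Fin m → R)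
    (ℳ : ℤ → Submodule k0 M) : WithBot (WithTop ℤ) :=
  sSup { w | ∃ z : ℤ, w = ((z : WithTop ℤ) : WithBot (WithTop ℤ)) ∧
    ∃ i : ℕ, gradedLocalCohNE x ℳ i (z - i) }

namespace KoszulLimit

section Complex

variable {R M M' : Type*} [CommRing R] [AddCommGroup M] [Module R M]
  [AddCommGroup M'] [Module R M'] {m : ℕ}

/-- The sign attached to removing `i` from `G` in the Koszul differential. -/
def sgn (i : Fin m) (G : Finset (Fin m)) : ℤ := (-1) ^ (G.filter (· < i)).card

theorem sgn_mul_self (i : Fin m) (G : Finset (Fin m)) : sgn i G * sgn i G = 1 := by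
  rw [sgn, ← mul_pow]; simp

theorem sgn_erase {i k : Fin m} {G : Finset (Fin m)} (hi : i ∈ G) :
    sgn k (G.erase i) = if i < k then -sgn k G else sgn k G := by
  unfold sgn
  split_ifs with h
  · have hi' : i ∈ G.filter (· < k) := by simp [hi, h]
    rw [Finset.filter_erase, ← Finset.card_erase_add_one hi', pow_succ]
    ring
  · have hi' : i ∉ G.filter (· < k) := by simp [h]
    rw [Finset.filter_erase, Finset.erase_eq_of_notMem hi']

theorem sgn_swap {i k : Fin m} {G : Finset (Fin m)} (hi : i ∈ G) (hk : k ∈ G) (h : i ≠ k) :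
    sgn i G * sgn k (G.erase i) + sgn k G * sgn i (G.erase k) = 0 := by
  rw [sgn_erase hi, sgn_erase hk]
  rcases lt_or_gt_of_ne h with h | h
  · rw [if_pos h, if_neg h.not_gt]; ring
  · rw [if_neg h.not_gt, if_pos h]; ring

/-- The Koszul differential as a linear map. -/
def diff (x : Fin m → R) (t : ℕ) : (Finset (Fin m) → M) →ₗ[R] (Finset (Fin m) → M) where
  toFun := koszulD x t
  map_add' ω η := by
    funext G
    simp [koszulD, smul_add, Finset.sum_add_distrib]
  map_smul' r ω := by
    funext G
    simp only [koszulD, Pi.smul_apply, RingHom.id_apply, Finset.smul_sum]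
    refine Finset.sum_congr rfl fun i _ => ?_
    rw [smul_comm r, smul_comm r]

theorem diff_apply (x : Fin m → R) (t : ℕ) (ω : Finset (Fin m) → M) (G : Finset (Fin m)) :
    diff x t ω G = ∑ i ∈ G, sgn i G • (x i ^ t • ω (G.erase i)) := rfl

/-- The transition map of Koszul complexes as a linear map. -/
def trans (x : Fin m → R) (t t' : ℕ) : (Finset (Fin m) → M) →ₗ[R] (Finset (Fin m) → M) where
  toFun := koszulTrans x t t'
  map_add' ω η := by funext G; simp [koszulTrans]
  map_smul' r ω := by
    funext G
    simp only [koszulTrans, Pi.smul_apply, RingHom.id_apply]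
    rw [smul_comm]

theorem trans_apply (x : Fin m → R) (t t' : ℕ) (ω : Finset (Fin m) → M) (G : Finset (Fin m)) :
    trans x t t' ω G = (∏ l ∈ G, x l) ^ (t' - t) • ω G := rfl

theorem diff_diff (x : Fin m → R) (t : ℕ) (ω : Finset (Fin m) → M) :
    diff x t (diff x t ω) = 0 := by
  funext G
  simp only [diff_apply, Finset.smul_sum, Pi.zero_apply]
  rw [Finset.sum_sigma']
  refine Finset.sum_involution (fun a _ => ⟨a.2, a.1⟩) ?_ ?_ ?_ ?_
  · rintro ⟨i, k⟩ h
    simp only [Finset.mem_sigma, Finset.mem_erase] at h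
    dsimp only
    rw [smul_comm (x i ^ t) (sgn k _), smul_comm (x k ^ t) (sgn i _),
      smul_comm (x k ^ t) (x i ^ t), Finset.erase_right_comm (a := k), smul_smul (sgn i G),
      smul_smul (sgn k G), ← add_smul, sgn_swap h.1 h.2.2 h.2.1.symm, zero_smul]
  · rintro ⟨i, k⟩ h _ h'
    simp only [Finset.mem_sigma, Finset.mem_erase] at h
    simp only [Sigma.mk.injEq] at h'
    exact h.2.1 h'.1
  · rintro ⟨i, k⟩ h
    simp only [Finset.mem_sigma, Finset.mem_erase] at h ⊢
    exact ⟨h.2.2, h.2.1.symm, h.1⟩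
  · rintro ⟨i, k⟩ h
    rfl

theorem diff_trans (x : Fin m → R) {t t' : ℕ} (h : t ≤ t') (ω : Finset (Fin m) → M) :
    diff x t' (trans x t t' ω) = trans x t t' (diff x t ω) := by
  funext G
  simp only [diff_apply, trans_apply, Finset.smul_sum]
  refine Finset.sum_congr rfl fun i hi => ?_
  rw [smul_comm _ (sgn i G), smul_smul, smul_smul, ← Finset.mul_prod_erase G x hi, mul_pow]
  congr 2
  rw [mul_right_comm, ← pow_add, Nat.sub_add_cancel h]

theorem trans_trans (x : Fin m → R) {t t' t'' : ℕ} (h : t ≤ t') (h' : t' ≤ t'')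
    (ω : Finset (Fin m) → M) :
    trans x t' t'' (trans x t t' ω) = trans x t t'' ω := by
  funext G
  simp only [trans_apply]
  rw [smul_smul, ← pow_add]
  congr 2
  omega

theorem diff_map (x : Fin m → R) (t : ℕ) (f : M →ₗ[R] M') (ω : Finset (Fin m) → M) :
    diff x t (f.compLeft _ ω) = f.compLeft _ (diff x t ω) := by
  funext G
  simp [diff_apply]

theorem trans_map (x : Fin m → R) (t t' : ℕ) (f : M →ₗ[R] M') (ω : Finset (Fin m) → M) :
    trans x t t' (f.compLeft _ ω) = f.compLeft _ (trans x t t' ω) := by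
  funext G
  simp [trans_apply]

/-- Contraction against the `l`-th basis covector. -/
def contract (l : Fin m) (ω : Finset (Fin m) → M) : Finset (Fin m) → M :=
  fun G => if l ∈ G then 0 else sgn l G • ω (insert l G)

theorem diff_contract (x : Fin m → R) (t : ℕ) (l : Fin m) (ω : Finset (Fin m) → M) :
    diff x t (contract l ω) + contract l (diff x t ω) = x l ^ t • ω := by
  funext G
  simp only [Pi.add_apply, Pi.smul_apply, diff_apply, contract]
  by_cases hl : l ∈ G
  · rw [if_pos hl, add_zero, Finset.sum_eq_single_of_mem l hl]
    · rw [if_neg (by simp), Finset.insert_erase hl, smul_comm (x l ^ t), smul_smul,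
        sgn_erase hl, if_neg (lt_irrefl l), sgn_mul_self, one_smul]
    · intro i _ hi
      rw [if_pos (by simp [hl, hi.symm]), smul_zero, smul_zero]
  · have key : sgn l (insert l G) = sgn l G := by
      have := sgn_erase (k := l) (Finset.mem_insert_self l G)
      rw [Finset.erase_insert hl, if_neg (lt_irrefl l)] at this
      exact this.symm
    rw [if_neg hl, Finset.sum_insert hl, smul_add, Finset.erase_insert hl, key, smul_smul,
      sgn_mul_self, one_smul, add_left_comm, add_eq_left, Finset.smul_sum,
      ← Finset.sum_add_distrib]
    refine Finset.sum_eq_zero fun i hi => ?_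
    have hil : i ≠ l := fun h => hl (h ▸ hi)
    have hi' : i ∈ insert l G := Finset.mem_insert_of_mem hi
    rw [if_neg (by simp [hl]), smul_comm (x i ^ t), smul_smul, smul_smul,
      Finset.erase_insert_of_ne hil.symm, ← add_smul]
    have h1 := sgn_swap hi' (Finset.mem_insert_self l G) hil
    rw [Finset.erase_insert hl, key, Finset.erase_insert_of_ne hil.symm] at h1
    have h2 : sgn l (insert l (G.erase i)) = sgn l (G.erase i) := by
      have := sgn_erase (k := l) (Finset.mem_insert_self l (G.erase i))
      rw [Finset.erase_insert (by simp [hl]), if_neg (lt_irrefl l)] at this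
      exact this.symm
    rw [h2] at h1
    have h3 : sgn i G * sgn l (G.erase i) + sgn l G * sgn i (insert l G) = 0 := by
      have e1 := sgn_mul_self l G
      have e2 := sgn_mul_self l (G.erase i)
      linear_combination (sgn l G * sgn l (G.erase i)) * h1
        - (sgn i (insert l G) * sgn l G) * e2 - (sgn i G * sgn l (G.erase i)) * e1 
    rw [h3, zero_smul]

end Complex

section Cohomology

variable {R M A B C : Type*} [CommRing R] [AddCommGroup M] [Module R M]
  [AddCommGroup A] [Module R A] [AddCommGroup B] [Module R B] [AddCommGroup C] [Module R C]
  {m : ℕ}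

/-- The Koszul `p`-cochains of internal degree `j`. -/
def coch (m : ℕ) (ℳ : ℤ → AddSubgroup M) (t : ℕ) (p j : ℤ) :
    AddSubgroup (Finset (Fin m) → M) where
  carrier := {ω | ∀ G, ω G ∈ ℳ (j + t * (G.card : ℤ)) ∧ ((G.card : ℤ) ≠ p → ω G = 0)}
  zero_mem' G := ⟨zero_mem _, fun _ => rfl⟩
  add_mem' h h' G := ⟨add_mem (h G).1 (h' G).1, fun hG => by
    rw [Pi.add_apply, (h G).2 hG, (h' G).2 hG, add_zero]⟩
  neg_mem' h G := ⟨neg_mem (h G).1, fun hG => by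
    rw [Pi.neg_apply, (h G).2 hG, neg_zero]⟩

theorem coch_eq_zero_of_neg {ℳ : ℤ → AddSubgroup M} {t : ℕ} {p j : ℤ} (hp : p < 0)
    {ω : Finset (Fin m) → M} (h : ω ∈ coch m ℳ t p j) : ω = 0 := by
  funext G
  exact (h G).2 (by have : (0 : ℤ) ≤ G.card := by positivity
                    omega)

theorem coch_eq_zero_of_gt {ℳ : ℤ → AddSubgroup M} {t : ℕ} {p j : ℤ} (hp : (m : ℤ) < p)
    {ω : Finset (Fin m) → M} (h : ω ∈ coch m ℳ t p j) : ω = 0 := by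
  funext G
  refine (h G).2 ?_
  have := Finset.card_le_univ G
  rw [Fintype.card_fin] at this
  omega

/-- Multiplication by each `x l` raises the degree by one. -/
def DegOne (x : Fin m → R) (ℳ : ℤ → AddSubgroup M) : Prop :=
  ∀ l j, ∀ y ∈ ℳ j, x l • y ∈ ℳ (j + 1)

theorem DegOne.pow_smul_mem {x : Fin m → R} {ℳ : ℤ → AddSubgroup M} (h : DegOne x ℳ)
    (l : Fin m) (n : ℕ) {j : ℤ} {y : M} (hy : y ∈ ℳ j) : x l ^ n • y ∈ ℳ (j + n) := by
  induction n with
  | zero => simpa using hy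
  | succ n ih =>
    rw [pow_succ', mul_smul, Nat.cast_succ, ← add_assoc]
    exact h l _ _ ih

theorem DegOne.prod_smul_mem {x : Fin m → R} {ℳ : ℤ → AddSubgroup M} (h : DegOne x ℳ)
    (G : Finset (Fin m)) (n : ℕ) {j : ℤ} {y : M} (hy : y ∈ ℳ j) :
    (∏ l ∈ G, x l) ^ n • y ∈ ℳ (j + n * (G.card : ℤ)) := by
  induction G using Finset.induction_on with
  | empty => simpa using hy
  | insert a G ha ih =>
    rw [Finset.prod_insert ha, mul_pow, mul_smul, Finset.card_insert_of_notMem ha]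
    convert h.pow_smul_mem a n ih using 2
    push_cast
    ring

theorem diff_mem {x : Fin m → R} {ℳ : ℤ → AddSubgroup M} (h : DegOne x ℳ) {t : ℕ} {p j : ℤ}
    {ω : Finset (Fin m) → M} (hω : ω ∈ coch m ℳ t p j) :
    diff x t ω ∈ coch m ℳ t (p + 1) j := by
  intro G
  constructor
  · refine sum_mem fun i hi => zsmul_mem ?_ _
    convert h.pow_smul_mem i t (hω (G.erase i)).1 using 2
    rw [← Finset.card_erase_add_one hi]
    push_cast
    ring
  · intro hG
    refine Finset.sum_eq_zero fun i hi => ?_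
    rw [(hω _).2, smul_zero, smul_zero]
    rw [← Finset.card_erase_add_one hi] at hG
    push_cast at hG
    omega

theorem trans_mem {x : Fin m → R} {ℳ : ℤ → AddSubgroup M} (h : DegOne x ℳ) {t t' : ℕ}
    (htt : t ≤ t') {p j : ℤ} {ω : Finset (Fin m) → M} (hω : ω ∈ coch m ℳ t p j) :
    trans x t t' ω ∈ coch m ℳ t' p j := by
  intro G
  constructor
  · rw [trans_apply]
    convert h.prod_smul_mem G (t' - t) (hω G).1 using 2
    push_cast [htt]
    ring
  · intro hG
    rw [trans_apply, (hω G).2 hG, smul_zero]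

theorem contract_mem {ℳ : ℤ → AddSubgroup M} {t : ℕ} {p j : ℤ} (l : Fin m)
    {ω : Finset (Fin m) → M} (hω : ω ∈ coch m ℳ t p j) :
    contract l ω ∈ coch m ℳ t (p - 1) (j + t) := by
  intro G
  simp only [contract]
  split_ifs with hl
  · exact ⟨zero_mem _, fun _ => rfl⟩
  · have hc := Finset.card_insert_of_notMem hl
    refine ⟨zsmul_mem ?_ _, fun hG => ?_⟩
    · convert (hω (insert l G)).1 using 2
      rw [hc]
      push_cast
      ring
    · rw [(hω _).2, smul_zero]
      rw [hc]
      push_cast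
      omega

/-- The class of the cochain `ω` vanishes in the direct limit of Koszul cohomologies. -/
def LimZero (x : Fin m → R) (ℳ : ℤ → AddSubgroup M) (p j : ℤ) (t : ℕ)
    (ω : Finset (Fin m) → M) : Prop :=
  ∃ t', t ≤ t' ∧ ∃ η ∈ coch m ℳ t' (p - 1) j, diff x t' η = trans x t t' ω

/-- The degree-`j` piece of the `p`-th local cohomology vanishes. -/
def Van (x : Fin m → R) (ℳ : ℤ → AddSubgroup M) (p j : ℤ) : Prop :=
  ∀ t, ∀ ω ∈ coch m ℳ t p j, diff x t ω = 0 → LimZero x ℳ p j t ω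

theorem limZero_zero (x : Fin m → R) (ℳ : ℤ → AddSubgroup M) (p j : ℤ) (t : ℕ) :
    LimZero x ℳ p j t 0 :=
  ⟨t, le_rfl, 0, zero_mem _, by simp⟩

theorem van_of_neg (x : Fin m → R) (ℳ : ℤ → AddSubgroup M) {p : ℤ} (hp : p < 0) (j : ℤ) :
    Van x ℳ p j := fun t ω hω _ => by
  rw [coch_eq_zero_of_neg hp hω]
  exact limZero_zero ..

theorem van_of_gt (x : Fin m → R) (ℳ : ℤ → AddSubgroup M) {p : ℤ} (hp : (m : ℤ) < p) (j : ℤ) :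
    Van x ℳ p j := fun t ω hω _ => by
  rw [coch_eq_zero_of_gt hp hω]
  exact limZero_zero ..

theorem van_of_subsingleton [Subsingleton M] (x : Fin m → R) (ℳ : ℤ → AddSubgroup M) (p j : ℤ) :
    Van x ℳ p j := fun t ω _ _ => by
  rw [Subsingleton.elim ω 0]
  exact limZero_zero ..

theorem LimZero.exists_of_le {x : Fin m → R} {ℳ : ℤ → AddSubgroup M} (hx : DegOne x ℳ)
    {p j : ℤ} {t : ℕ} {ω : Finset (Fin m) → M} (h : LimZero x ℳ p j t ω) :
    ∃ T, t ≤ T ∧ ∀ T', T ≤ T' →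
      ∃ η ∈ coch m ℳ T' (p - 1) j, diff x T' η = trans x t T' ω := by
  obtain ⟨t', h', η, hη, e⟩ := h
  refine ⟨t', h', fun T' hT => ⟨trans x t' T' η, trans_mem hx hT hη, ?_⟩⟩
  rw [diff_trans x hT, e, trans_trans x h' hT]

theorem LimZero.add {x : Fin m → R} {ℳ : ℤ → AddSubgroup M} (hx : DegOne x ℳ)
    {p j : ℤ} {t : ℕ} {ω ω' : Finset (Fin m) → M} (h : LimZero x ℳ p j t ω)
    (h' : LimZero x ℳ p j t ω') : LimZero x ℳ p j t (ω + ω') := by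
  obtain ⟨T, hT, H⟩ := h.exists_of_le hx
  obtain ⟨T', -, H'⟩ := h'.exists_of_le hx
  obtain ⟨η, hη, e⟩ := H (max T T') (le_max_left _ _)
  obtain ⟨η', hη', e'⟩ := H' (max T T') (le_max_right _ _)
  exact ⟨max T T', hT.trans (le_max_left _ _), η + η', add_mem hη hη', by simp [e, e']⟩

/-- A short exact sequence `0 → A → B → C → 0`, strictly compatible with the gradings. -/
structure GradedExact (x : Fin m → R) (𝒜 : ℤ → AddSubgroup A) (ℬ : ℤ → AddSubgroup B)
    (𝒞 : ℤ → AddSubgroup C) (f : A →ₗ[R] B) (g : B →ₗ[R] C) : Prop where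
  inj : Function.Injective f
  exact : ∀ b, g b = 0 → ∃ a, f a = b
  comp : ∀ a, g (f a) = 0
  memA : ∀ j a, a ∈ 𝒜 j ↔ f a ∈ ℬ j
  memC : ∀ j c, c ∈ 𝒞 j ↔ ∃ b ∈ ℬ j, g b = c
  degOne : DegOne x ℬ

namespace GradedExact

variable {x : Fin m → R} {𝒜 : ℤ → AddSubgroup A} {ℬ : ℤ → AddSubgroup B}
  {𝒞 : ℤ → AddSubgroup C} {f : A →ₗ[R] B} {g : B →ₗ[R] C}

theorem map_mem (E : GradedExact x 𝒜 ℬ 𝒞 f g)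
    {t : ℕ} {p j : ℤ} {ω : Finset (Fin m) → A} (h : ω ∈ coch m 𝒜 t p j) :
    f.compLeft _ ω ∈ coch m ℬ t p j := fun G =>
  ⟨(E.memA _ _).1 (h G).1, fun hG => by simp [(h G).2 hG]⟩

theorem map_memC (E : GradedExact x 𝒜 ℬ 𝒞 f g)
    {t : ℕ} {p j : ℤ} {ω : Finset (Fin m) → B} (h : ω ∈ coch m ℬ t p j) :
    g.compLeft _ ω ∈ coch m 𝒞 t p j := fun G =>
  ⟨(E.memC _ _).2 ⟨_, (h G).1, rfl⟩, fun hG => by simp [(h G).2 hG]⟩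

theorem lift (E : GradedExact x 𝒜 ℬ 𝒞 f g)
    {t : ℕ} {p j : ℤ} {ω : Finset (Fin m) → C} (h : ω ∈ coch m 𝒞 t p j) :
    ∃ β ∈ coch m ℬ t p j, g.compLeft _ β = ω := by
  have : ∀ G, ∃ b, (b ∈ ℬ (j + t * (G.card : ℤ)) ∧ ((G.card : ℤ) ≠ p → b = 0)) ∧ g b = ω G := by
    intro G
    by_cases hG : (G.card : ℤ) = p
    · obtain ⟨b, hb, e⟩ := (E.memC _ _).1 (h G).1
      exact ⟨b, ⟨hb, fun h => (h hG).elim⟩, e⟩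
    · exact ⟨0, ⟨zero_mem _, fun _ => rfl⟩, by rw [(h G).2 hG, map_zero]⟩
  choose β hβ e using this
  exact ⟨β, hβ, funext e⟩

theorem lift_ker (E : GradedExact x 𝒜 ℬ 𝒞 f g)
    {t : ℕ} {p j : ℤ} {β : Finset (Fin m) → B} (h : β ∈ coch m ℬ t p j)
    (h0 : g.compLeft _ β = 0) : ∃ α ∈ coch m 𝒜 t p j, f.compLeft _ α = β := by
  have : ∀ G, ∃ a, f a = β G := fun G => E.exact _ (congrFun h0 G)
  choose α hα using this
  refine ⟨α, fun G => ⟨?_, fun hG => E.inj ?_⟩, funext hα⟩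
  · rw [E.memA, hα]
    exact (h G).1
  · rw [hα, (h G).2 hG, map_zero]

theorem inj_map (E : GradedExact x 𝒜 ℬ 𝒞 f g) {α α' : Finset (Fin m) → A}
    (h : f.compLeft _ α = f.compLeft _ α') : α = α' :=
  funext fun G => E.inj (congrFun h G)

theorem comp_map (E : GradedExact x 𝒜 ℬ 𝒞 f g)
    (α : Finset (Fin m) → A) : g.compLeft _ (f.compLeft _ α) = 0 :=
  funext fun G => E.comp (α G)

theorem van_middle (E : GradedExact x 𝒜 ℬ 𝒞 f g)
    {p j : ℤ} (hA : Van x 𝒜 p j) (hC : Van x 𝒞 p j) : Van x ℬ p j := by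
  intro t ω hω hd
  obtain ⟨t', ht, η', hη', e⟩ := hC t _ (E.map_memC hω) (by rw [diff_map, hd, map_zero])
  obtain ⟨η, hη, rfl⟩ := E.lift hη'
  have hdη := diff_mem E.degOne hη
  rw [sub_add_cancel] at hdη
  obtain ⟨α, hα, eα⟩ := E.lift_ker (sub_mem (trans_mem E.degOne ht hω) hdη)
    (by rw [map_sub, ← trans_map, ← diff_map, e, sub_self])
  have hdα : diff x t' α = 0 := E.inj_map (by
    rw [← diff_map, eα, map_sub, diff_diff, diff_trans x ht, hd]; simp)
  obtain ⟨T, hT, ξ, hξ, e'⟩ := hA t' α hα hdα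
  refine ⟨T, ht.trans hT, trans x t' T η + f.compLeft _ ξ,
    add_mem (trans_mem E.degOne hT hη) (E.map_mem hξ), ?_⟩
  rw [map_add, diff_trans x hT, diff_map, e', ← trans_map, eα, map_sub, trans_trans x ht hT]
  abel

theorem van_right (E : GradedExact x 𝒜 ℬ 𝒞 f g)
    {p j : ℤ} (hB : Van x ℬ p j) (hA : Van x 𝒜 (p + 1) j) : Van x 𝒞 p j := by
  intro t ω' hω' hd
  obtain ⟨ω, hω, rfl⟩ := E.lift hω'
  rw [diff_map] at hd
  obtain ⟨α, hα, eα⟩ := E.lift_ker (diff_mem E.degOne hω) hd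
  have hdα : diff x t α = 0 := E.inj_map (by rw [← diff_map, eα, diff_diff]; simp)
  obtain ⟨t', ht, ξ, hξ, e⟩ := hA t α hα hdα
  rw [add_sub_cancel_right] at hξ
  obtain ⟨T, hT, η, hη, e'⟩ := hB t' (trans x t t' ω - f.compLeft _ ξ)
    (sub_mem (trans_mem E.degOne ht hω) (E.map_mem hξ))
    (by rw [map_sub, diff_trans x ht, diff_map, e, ← trans_map, eα, sub_self])
  refine ⟨T, ht.trans hT, g.compLeft _ η, E.map_memC hη, ?_⟩
  rw [diff_map, e', map_sub, trans_trans x ht hT, map_sub, trans_map _ _ _ f, E.comp_map,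
    sub_zero, trans_map]

theorem limZero_left (E : GradedExact x 𝒜 ℬ 𝒞 f g)
    {p j : ℤ} (hC : Van x 𝒞 (p - 1) j) {t : ℕ} {ω : Finset (Fin m) → A}
    (h : LimZero x ℬ p j t (f.compLeft _ ω)) : LimZero x 𝒜 p j t ω := by
  obtain ⟨t', ht, η, hη, e⟩ := h
  obtain ⟨T, hT, ζ', hζ', e'⟩ := hC t' (g.compLeft _ η) (E.map_memC hη)
    (by rw [diff_map, e, trans_map, E.comp_map])
  obtain ⟨ζ, hζ, rfl⟩ := E.lift hζ'
  have hdζ := diff_mem E.degOne hζ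
  rw [sub_add_cancel] at hdζ
  obtain ⟨ξ, hξ, eξ⟩ := E.lift_ker (sub_mem (trans_mem E.degOne hT hη) hdζ)
    (by rw [map_sub, ← trans_map, ← diff_map, e', sub_self])
  refine ⟨T, ht.trans hT, ξ, hξ, E.inj_map ?_⟩
  rw [← diff_map, eξ, map_sub, diff_diff, diff_trans x hT, e, trans_trans x ht hT, trans_map,
    sub_zero]

end GradedExact

/-- If `y` is regular of degree `d` and every class is killed by a power of `y`, then vanishing
for `M / yM` in cohomological degree `p - 1` gives vanishing for `M` in degree `p`. -/
theorem van_of_smul_exact {x : Fin m → R} {ℳ : ℤ → AddSubgroup M} {𝒞 : ℤ → AddSubgroup C}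
    {y : R} {d : ℕ} {g : M →ₗ[R] C}
    (E : GradedExact x (fun j => ℳ (j - d)) ℳ 𝒞 (LinearMap.lsmul R M y) g) {p j : ℤ}
    (hC : ∀ j', j ≤ j' → Van x 𝒞 (p - 1) j')
    (htors : ∀ t, ∀ ω ∈ coch m ℳ t p j, diff x t ω = 0 →
      ∃ n : ℕ, LimZero x ℳ p (j + n * d) t (y ^ n • ω)) : Van x ℳ p j := by
  have key : ∀ n : ℕ, ∀ t (ω : Finset (Fin m) → M),
      LimZero x ℳ p (j + n * d) t (y ^ n • ω) → LimZero x ℳ p j t ω := by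
    intro n
    induction n with
    | zero => intro t ω h; simpa using h
    | succ n ih =>
      intro t ω h
      apply ih
      have e : y ^ (n + 1) • ω = (LinearMap.lsmul R M y).compLeft _ (y ^ n • ω) := by
        funext G
        change y ^ (n + 1) • ω G = y • y ^ n • ω G
        rw [pow_succ', mul_smul]
      rw [e] at h
      obtain ⟨t', ht, η, hη, e'⟩ := E.limZero_left
        (hC _ (le_add_of_nonneg_right (by positivity))) h
      refine ⟨t', ht, η, fun G => ⟨?_, (hη G).2⟩, e'⟩
      convert (hη G).1 using 2
      push_cast
      ring
  intro t ω hω hd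
  obtain ⟨n, hn⟩ := htors t ω hω hd
  exact key n t ω hn

theorem limZero_pow_smul {x : Fin m → R} {ℳ : ℤ → AddSubgroup M} {p j : ℤ} {t : ℕ}
    {ω : Finset (Fin m) → M} (hω : ω ∈ coch m ℳ t p j) (hd : diff x t ω = 0) (l : Fin m) :
    LimZero x ℳ p (j + t) t (x l ^ t • ω) := by
  refine ⟨t, le_rfl, contract l ω, contract_mem l hω, ?_⟩
  have h := diff_contract x t l ω
  rw [hd] at h
  have h0 : contract l (0 : Finset (Fin m) → M) = 0 := by
    funext G; simp [contract]
  rw [h0, add_zero] at h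
  rw [h]
  funext G
  simp [trans_apply]

end Cohomology

section Graded

variable {k0 R M : Type} [Field k0] [CommRing R] [Algebra k0 R] [AddCommGroup M] [Module R M]
  {m : ℕ}

/-- `π j` is the projection of the graded module `M` onto its degree-`j` piece `ℳ j`. -/
structure IsProj (𝒜 : ℕ → Submodule k0 R) (ℳ : ℤ → AddSubgroup M) (π : ℤ → M → M) : Prop where
  add : ∀ j y z, π j (y + z) = π j y + π j z
  mem : ∀ j y, π j y ∈ ℳ j
  of_mem : ∀ i j, ∀ y ∈ ℳ i, π j y = if i = j then y else 0
  smul : ∀ d : ℕ, ∀ r ∈ 𝒜 d, ∀ j y, π (j + d) (r • y) = r • π j y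
  sum : ∀ y, ∃ F : Finset ℤ, (∀ j ∉ F, π j y = 0) ∧ ∑ j ∈ F, π j y = y

namespace IsProj

variable {𝒜 : ℕ → Submodule k0 R} {ℳ : ℤ → AddSubgroup M} {π : ℤ → M → M}

theorem zero (P : IsProj 𝒜 ℳ π) (j : ℤ) : π j 0 = 0 := by
  have := P.add j 0 0
  rw [add_zero] at this
  exact left_eq_add.1 this

theorem self (P : IsProj 𝒜 ℳ π) {j : ℤ} {y : M} (hy : y ∈ ℳ j) : π j y = y := by
  rw [P.of_mem j j y hy, if_pos rfl]

theorem finset_sum (P : IsProj 𝒜 ℳ π) (j : ℤ) {ι : Type*} (s : Finset ι) (y : ι → M) :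
    π j (∑ i ∈ s, y i) = ∑ i ∈ s, π j (y i) :=
  map_sum (AddMonoidHom.mk' (π j) (P.add j)) y s

theorem zsmul (P : IsProj 𝒜 ℳ π) (j : ℤ) (n : ℤ) (y : M) : π j (n • y) = n • π j y :=
  map_zsmul (AddMonoidHom.mk' (π j) (P.add j)) n y

theorem sub (P : IsProj 𝒜 ℳ π) (j : ℤ) (y z : M) : π j (y - z) = π j y - π j z :=
  map_sub (AddMonoidHom.mk' (π j) (P.add j)) y z

theorem smul' (P : IsProj 𝒜 ℳ π) {d : ℕ} {r : R} (hr : r ∈ 𝒜 d) (j : ℤ) (y : M) :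
    π j (r • y) = r • π (j - d) y := by
  rw [← P.smul d r hr, sub_add_cancel]

theorem smul_mem (P : IsProj 𝒜 ℳ π) {d : ℕ} {r : R} (hr : r ∈ 𝒜 d) {j : ℤ} {y : M}
    (hy : y ∈ ℳ j) : r • y ∈ ℳ (j + d) := by
  rw [← P.self hy, ← P.smul d r hr]
  exact P.mem _ _

theorem degOne (P : IsProj 𝒜 ℳ π) {x : Fin m → R} (hx : ∀ l, x l ∈ 𝒜 1) : DegOne x ℳ :=
  fun l j y hy => by simpa using P.smul_mem (hx l) hy

theorem submodule (P : IsProj 𝒜 ℳ π) (N : Submodule R M) (hN : ∀ j, ∀ y ∈ N, π j y ∈ N) :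
    IsProj 𝒜 (fun j => (ℳ j).comap N.subtype.toAddMonoidHom)
      (fun j (y : N) => (⟨π j y, hN j y y.2⟩ : N)) where
  add j y z := Subtype.ext (P.add j y z)
  mem j y := P.mem j y
  of_mem i j y hy := Subtype.ext (by
    refine (P.of_mem i j y hy).trans ?_
    split_ifs <;> rfl)
  smul d r hr j y := Subtype.ext (P.smul d r hr j y)
  sum y := by
    obtain ⟨F, hF, e⟩ := P.sum y
    refine ⟨F, fun j hj => Subtype.ext (hF j hj), Subtype.ext ?_⟩
    rw [← N.subtype_apply (∑ j ∈ F, _), map_sum]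
    exact e

theorem quotient (P : IsProj 𝒜 ℳ π) (N : Submodule R M) (hN : ∀ j, ∀ y ∈ N, π j y ∈ N) :
    ∃ ϖ : ℤ → M ⧸ N → M ⧸ N, IsProj 𝒜 (fun j => (ℳ j).map N.mkQ.toAddMonoidHom) ϖ := by
  have hs := N.mkQ_surjective
  refine ⟨fun j c => N.mkQ (π j (Function.surjInv hs c)), ?_⟩
  have key : ∀ j y, N.mkQ (π j (Function.surjInv hs (N.mkQ y))) = N.mkQ (π j y) := by
    intro j y
    have h1 := Function.surjInv_eq hs (N.mkQ y)
    rw [← sub_eq_zero, ← map_sub] at h1 ⊢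
    rw [Submodule.mkQ_apply, Submodule.Quotient.mk_eq_zero] at h1 ⊢
    rw [← P.sub]
    exact hN j _ h1
  refine ⟨?_, ?_, ?_, ?_, ?_⟩
  · intro j y z
    obtain ⟨y, rfl⟩ := hs y
    obtain ⟨z, rfl⟩ := hs z
    rw [← map_add, key, key, key, P.add, map_add]
  · intro j y
    exact ⟨_, P.mem j _, rfl⟩
  · rintro i j _ ⟨y, hy, rfl⟩
    refine (key j y).trans ?_
    rw [P.of_mem i j y hy]
    split_ifs
    · rfl
    · exact map_zero _
  · intro d r hr j y
    obtain ⟨y, rfl⟩ := hs y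
    rw [← map_smul, key, key, P.smul d r hr, map_smul]
  · intro y
    obtain ⟨y, rfl⟩ := hs y
    obtain ⟨F, hF, e⟩ := P.sum y
    refine ⟨F, fun j hj => by rw [key, hF j hj, map_zero], ?_⟩
    simp_rw [key]
    rw [← map_sum, e]

theorem exact_quotient (P : IsProj 𝒜 ℳ π) {x : Fin m → R} (hx : ∀ l, x l ∈ 𝒜 1)
    (N : Submodule R M) :
    GradedExact x (fun j => (ℳ j).comap N.subtype.toAddMonoidHom) ℳ
      (fun j => (ℳ j).map N.mkQ.toAddMonoidHom) N.subtype N.mkQ where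
  inj := N.injective_subtype
  exact b hb := ⟨⟨b, (Submodule.Quotient.mk_eq_zero N).1 hb⟩, rfl⟩
  comp a := (Submodule.Quotient.mk_eq_zero N).2 a.2
  memA _ _ := Iff.rfl
  memC _ _ := Iff.rfl
  degOne := P.degOne hx

theorem exact_smul (P : IsProj 𝒜 ℳ π) {x : Fin m → R} (hx : ∀ l, x l ∈ 𝒜 1)
    {y : R} {d : ℕ} (hy : y ∈ 𝒜 d) (hreg : ∀ z : M, y • z = 0 → z = 0) :
    GradedExact x (fun j => ℳ (j - d)) ℳ
      (fun j => (ℳ j).map (LinearMap.range (LinearMap.lsmul R M y)).mkQ.toAddMonoidHom)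
      (LinearMap.lsmul R M y) (LinearMap.range (LinearMap.lsmul R M y)).mkQ where
  inj := (injective_iff_map_eq_zero _).2 hreg
  exact b hb := (Submodule.Quotient.mk_eq_zero _).1 hb
  comp a := (Submodule.Quotient.mk_eq_zero _).2 ⟨a, rfl⟩
  memA j a := by
    constructor
    · intro h
      simpa using P.smul_mem hy h
    · intro h
      have h1 := P.self h
      rw [LinearMap.lsmul_apply, P.smul' hy, ← sub_eq_zero, ← smul_sub] at h1
      rw [← sub_eq_zero.1 (hreg _ h1)]
      exact P.mem _ _
  memC _ _ := Iff.rfl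
  degOne := P.degOne hx

end IsProj

/-- The degree-`j` component of a Koszul cochain. -/
def comp (π : ℤ → M → M) (t : ℕ) (j : ℤ) (ω : Finset (Fin m) → M) : Finset (Fin m) → M :=
  fun G => π (j + t * (G.card : ℤ)) (ω G)

variable {𝒜 : ℕ → Submodule k0 R} {ℳ : ℤ → AddSubgroup M} {π : ℤ → M → M}

theorem comp_mem (P : IsProj 𝒜 ℳ π) {t : ℕ} {p i : ℤ} (j : ℤ) {ω : Finset (Fin m) → M}
    (hω : ω ∈ coch m (fun _ => (⊤ : AddSubgroup M)) t p i) :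
    comp π t j ω ∈ coch m ℳ t p j := fun G =>
  ⟨P.mem _ _, fun hG => by rw [comp, (hω G).2 hG, P.zero]⟩

theorem comp_self (P : IsProj 𝒜 ℳ π) {t : ℕ} {p j : ℤ} {ω : Finset (Fin m) → M}
    (hω : ω ∈ coch m ℳ t p j) : comp π t j ω = ω :=
  funext fun G => P.self (hω G).1

theorem pow_mem_degree [GradedAlgebra 𝒜] {y : R} (hy : y ∈ 𝒜 1) (n : ℕ) : y ^ n ∈ 𝒜 n := by
  simpa using SetLike.pow_mem_graded n hy

theorem diff_comp [GradedAlgebra 𝒜] (P : IsProj 𝒜 ℳ π) {x : Fin m → R} (hx : ∀ l, x l ∈ 𝒜 1)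
    (t : ℕ) (j : ℤ) (ω : Finset (Fin m) → M) :
    diff x t (comp π t j ω) = comp π t j (diff x t ω) := by
  funext G
  simp only [comp, diff_apply]
  rw [P.finset_sum]
  refine Finset.sum_congr rfl fun i hi => ?_
  rw [P.zsmul, P.smul' (pow_mem_degree (hx i) t)]
  have e : j + t * (G.card : ℤ) - t = j + t * ((G.erase i).card : ℤ) := by
    rw [← Finset.card_erase_add_one hi]
    push_cast
    ring
  rw [e]

theorem van_of_van_top [GradedAlgebra 𝒜] (P : IsProj 𝒜 ℳ π) {x : Fin m → R}
    (hx : ∀ l, x l ∈ 𝒜 1) {p j : ℤ} (h : Van x (fun _ => (⊤ : AddSubgroup M)) p j) :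
    Van x ℳ p j := by
  intro t ω hω hd
  obtain ⟨t', ht, η, hη, e⟩ := h t ω (fun G => ⟨trivial, (hω G).2⟩) hd
  refine ⟨t', ht, comp π t' j η, comp_mem P j hη, ?_⟩
  rw [diff_comp P hx, e]
  exact comp_self P (trans_mem (P.degOne hx) ht hω)

theorem van_top_of_van [GradedAlgebra 𝒜] (P : IsProj 𝒜 ℳ π) {x : Fin m → R}
    (hx : ∀ l, x l ∈ 𝒜 1) {p : ℤ} (h : ∀ j, Van x ℳ p j) (i : ℤ) :
    Van x (fun _ => (⊤ : AddSubgroup M)) p i := by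
  intro t ω hω hd
  choose F hF hsum using P.sum
  have e : ∃ S : Finset ℤ, ∑ j ∈ S, comp π t j ω = ω := by
    refine ⟨Finset.univ.biUnion fun G => (F (ω G)).image (fun k => k - t * (G.card : ℤ)), ?_⟩
    funext G
    rw [Finset.sum_apply]
    simp only [comp]
    conv_rhs => rw [← hsum (ω G)]
    rw [← Finset.sum_subset (s₁ := (F (ω G)).image (fun k => k - t * (G.card : ℤ)))
      (Finset.subset_biUnion_of_mem
        (fun G => (F (ω G)).image (fun k => k - t * (G.card : ℤ))) (Finset.mem_univ G))]
    · rw [Finset.sum_image (fun a _ b _ h => sub_left_injective h)]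
      simp
    · intro j _ hj
      refine hF _ _ fun hmem => hj (Finset.mem_image.2 ⟨_, hmem, by ring⟩)
  obtain ⟨S, hS⟩ := e
  rw [← hS]
  have hx' : DegOne x (fun _ => (⊤ : AddSubgroup M)) := fun _ _ _ _ => trivial
  refine Finset.sum_induction _ _ (fun _ _ => LimZero.add hx')
    (limZero_zero ..) fun j _ => ?_
  obtain ⟨t', ht, η, hη, e⟩ := h j t (comp π t j ω) (comp_mem P j hω)
    (by rw [diff_comp P hx, hd]; funext G; exact P.zero _)
  exact ⟨t', ht, η, fun G => ⟨trivial, (hη G).2⟩, e⟩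

/-- Boundedness of the vanishing of local cohomology from above, and Grothendieck vanishing. -/
structure Bounded (x : Fin m → R) (I : Ideal R) (ℳ : ℤ → AddSubgroup M) : Prop where
  exists_bound : ∃ J : ℤ, ∀ p j, J < j → Van x ℳ p j
  of_dim_lt : ∀ n : ℕ, ringKrullDim (R ⧸ I) < n → ∀ p j, (n : ℤ) ≤ p → Van x ℳ p j

theorem ringKrullDim_quotient_le {I I' : Ideal R} (h : I ≤ I') :
    ringKrullDim (R ⧸ I') ≤ ringKrullDim (R ⧸ I) :=
  ringKrullDim_le_of_surjective (Ideal.Quotient.factor h) (Ideal.Quotient.factor_surjective h)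

theorem bounded_of_exact {A B C : Type} [AddCommGroup A] [Module R A] [AddCommGroup B]
    [Module R B] [AddCommGroup C] [Module R C] {x : Fin m → R} {𝒜' : ℤ → AddSubgroup A}
    {ℬ : ℤ → AddSubgroup B} {𝒞 : ℤ → AddSubgroup C} {f : A →ₗ[R] B} {g : B →ₗ[R] C}
    (E : GradedExact x 𝒜' ℬ 𝒞 f g) {I I₁ I₂ : Ideal R} (h₁ : I ≤ I₁) (h₂ : I ≤ I₂)
    (hA : Bounded x I₁ 𝒜') (hC : Bounded x I₂ 𝒞) : Bounded x I ℬ := by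
  obtain ⟨J₁, H₁⟩ := hA.exists_bound
  obtain ⟨J₂, H₂⟩ := hC.exists_bound
  exact ⟨⟨max J₁ J₂, fun p j hj => E.van_middle (H₁ p j ((le_max_left _ _).trans_lt hj))
      (H₂ p j ((le_max_right _ _).trans_lt hj))⟩,
    fun n hn p j hp => E.van_middle
      (hA.of_dim_lt n ((ringKrullDim_quotient_le h₁).trans_lt hn) p j hp)
      (hC.of_dim_lt n ((ringKrullDim_quotient_le h₂).trans_lt hn) p j hp)⟩

theorem bounded_of_annihilated [GradedAlgebra 𝒜] [Module.Finite R M] (P : IsProj 𝒜 ℳ π)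
    {x : Fin m → R} (hpos : ∀ d, 0 < d → ∀ r ∈ 𝒜 d, r ∈ Ideal.span (Set.range x))
    {I : Ideal R} (hxI : ∀ l, x l ∈ I) (hI : ∀ a ∈ I, ∀ y : M, a • y = 0) :
    Bounded x I ℳ := by
  have hspan : Ideal.span (Set.range x) ≤ I := by
    rw [Ideal.span_le]
    rintro _ ⟨l, rfl⟩
    exact hxI l
  have hne : ∀ p j : ℤ, p ≠ 0 → Van x ℳ p j := by
    intro p j hp t ω hω _
    refine ⟨t + 1, by omega, 0, zero_mem _, ?_⟩
    rw [map_zero]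
    funext G
    rw [trans_apply, add_tsub_cancel_left, pow_one, Pi.zero_apply]
    by_cases hG : (G.card : ℤ) = p
    · have hne : G.Nonempty := by
        rw [← Finset.card_pos]
        omega
      obtain ⟨l, hl⟩ := hne
      rw [← Finset.mul_prod_erase G x hl, mul_smul]
      exact (hI _ (hxI l) _).symm
    · rw [(hω G).2 hG, smul_zero]
  have hzero : ∀ j : ℤ, (∀ y ∈ ℳ j, y = 0) → Van x ℳ 0 j := by
    intro j hj t ω hω _
    have : ω = 0 := by
      funext G
      by_cases hG : (G.card : ℤ) = 0
      · refine hj _ ?_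
        simpa [hG] using (hω G).1
      · exact (hω G).2 hG
    rw [this]
    exact limZero_zero ..
  constructor
  · obtain ⟨S, hS⟩ := (Module.finite_def (R := R) (M := M)).1 inferInstance
    choose F hF hsum using P.sum
    obtain ⟨J, hJ⟩ := (S.biUnion F).bddAbove
    have hJ' : ∀ j, J < j → ∀ y : M, π j y = 0 := by
      intro j hj y
      have hy : y ∈ Submodule.span R (S : Set M) := hS ▸ Submodule.mem_top
      induction hy using Submodule.span_induction with
      | mem s hs =>
        refine hF _ _ fun h => hj.not_ge (hJ ?_)
        exact Finset.mem_coe.2 (Finset.mem_biUnion.2 ⟨s, hs, h⟩)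
      | zero => exact P.zero j
      | add y z _ _ hy hz => rw [P.add, hy, hz, add_zero]
      | smul r y _ hy =>
        induction r using DirectSum.Decomposition.inductionOn 𝒜 with
        | zero => rw [zero_smul, P.zero]
        | @homogeneous d r =>
          rcases Nat.eq_zero_or_pos d with rfl | hd
          · rw [P.smul' r.2, Nat.cast_zero, sub_zero, hy, smul_zero]
          · rw [hI _ (hspan (hpos d hd r r.2)), P.zero]
        | add r r' h h' => rw [add_smul, P.add, h, h', add_zero]
    refine ⟨J, fun p j hj => ?_⟩
    by_cases hp : p = 0
    · subst hp
      exact hzero j fun y hy => by rw [← P.self hy, hJ' j hj]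
    · exact hne p j hp
  · intro n hn p j hp
    by_cases hp0 : p = 0
    · obtain rfl : n = 0 := by omega
      have hI1 : I = ⊤ := by
        by_contra h
        have := Ideal.Quotient.nontrivial_iff.2 h
        exact (ringKrullDim_nonneg_of_nontrivial (R := R ⧸ I)).not_gt (by simpa using hn)
      have : Subsingleton M := ⟨fun a b => by
        rw [← one_smul R a, ← one_smul R b, hI 1 (hI1 ▸ trivial), hI 1 (hI1 ▸ trivial)]⟩
      exact van_of_subsingleton x ℳ p j
    · exact hne p j hp0

end Graded

section Induction

variable {k0 R : Type} [Field k0] [CommRing R] [Algebra k0 R] {𝒜 : ℕ → Submodule k0 R} {m : ℕ}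

theorem ringKrullDim_quotient_sup_span_lt {I : Ideal R} (hI : I.IsPrime) {y : R} (hy : y ∉ I)
    {n : ℕ} (hn : ringKrullDim (R ⧸ I) < (n + 1 : ℕ)) :
    ringKrullDim (R ⧸ I ⊔ Ideal.span {y}) < n := by
  have hy' : Ideal.Quotient.mk I y ∈ nonZeroDivisors (R ⧸ I) := by
    refine mem_nonZeroDivisors_of_ne_zero fun h => hy (Ideal.Quotient.eq_zero_iff_mem.1 h)
  have h1 := ringKrullDim_succ_le_of_surjective (Ideal.Quotient.factor (le_sup_left :
    I ≤ I ⊔ Ideal.span {y})) (Ideal.Quotient.factor_surjective _) hy' (by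
      rw [Ideal.Quotient.factor_mk]
      exact Ideal.Quotient.eq_zero_iff_mem.2
        (Ideal.mem_sup_right (Ideal.mem_span_singleton_self y)))
  have h2 := h1.trans_lt hn
  push_cast at h2
  by_contra h
  exact (add_le_add_left (not_lt.1 h) 1).not_gt h2

theorem smul_eq_zero_of_mem_sup {M : Type} [AddCommGroup M] [Module R M] {I : Ideal R} {y : R}
    (hI : ∀ a ∈ I, ∀ z : M, a • z = 0) (hy : ∀ z : M, y • z = 0) :
    ∀ a ∈ I ⊔ Ideal.span {y}, ∀ z : M, a • z = 0 := by
  have h : I ⊔ Ideal.span {y} ≤ Module.annihilator R M := by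
    refine sup_le (fun a ha => Module.mem_annihilator.2 (hI a ha)) ?_
    rw [Ideal.span_singleton_le_iff_mem]
    exact Module.mem_annihilator.2 hy
  exact fun a ha => Module.mem_annihilator.1 (h ha)

theorem bounded_of_homogeneous [IsNoetherianRing R] [GradedAlgebra 𝒜] {x : Fin m → R}
    (hx : ∀ l, x l ∈ 𝒜 1) (hpos : ∀ d, 0 < d → ∀ r ∈ 𝒜 d, r ∈ Ideal.span (Set.range x))
    (I : Ideal R) :
    I.IsHomogeneous 𝒜 → ∀ (M : Type) [AddCommGroup M] [Module R M] [Module.Finite R M]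
      (ℳ : ℤ → AddSubgroup M) (π : ℤ → M → M), IsProj 𝒜 ℳ π →
      (∀ a ∈ I, ∀ y : M, a • y = 0) → Bounded x I ℳ := by
  induction I using WellFoundedGT.induction with
  | _ I ih =>
  intro hIh M _ _ _ ℳ π P hI
  by_cases hxI : ∀ l, x l ∈ I
  · exact bounded_of_annihilated P hpos hxI hI
  obtain ⟨l, hl⟩ := not_forall.1 hxI
  have hlt : ∀ {a : R}, a ∉ I → I ⊔ Ideal.span {a} > I := fun {a} ha =>
    lt_of_le_of_ne le_sup_left fun h => ha (by
      rw [h]; exact Ideal.mem_sup_right (Ideal.mem_span_singleton_self a))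
  have hhom : ∀ {d : ℕ} {a : R}, a ∈ 𝒜 d → (I ⊔ Ideal.span {a}).IsHomogeneous 𝒜 := by
    intro d a ha
    refine hIh.sup (Ideal.homogeneous_span _ _ ?_)
    rintro _ rfl
    exact ⟨d, ha⟩
  by_cases hprime : I.IsPrime
  · -- divide out the `x l`-power torsion
    let K : ℕ →o Submodule R M :=
      ⟨fun n => LinearMap.ker (LinearMap.lsmul R M (x l ^ n)), fun n n' h z hz => by
        rw [LinearMap.mem_ker, LinearMap.lsmul_apply] at hz ⊢
        rw [← Nat.sub_add_cancel h, pow_add, mul_smul, hz, smul_zero]⟩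
    obtain ⟨n, hn⟩ := monotone_stabilizes_iff_noetherian.2 (inferInstance : IsNoetherian R M) K
    have hmemK : ∀ n z, z ∈ K n ↔ x l ^ n • z = 0 := fun n z => Iff.rfl
    have hxn : x l ^ n ∈ 𝒜 n := pow_mem_degree (hx l) n
    have hstab : ∀ j, ∀ y ∈ K n, π j y ∈ K n := by
      intro j y hy
      rw [hmemK] at hy ⊢
      rw [← P.smul n _ hxn, hy, P.zero]
    obtain ⟨ϖ, Pq⟩ := P.quotient (K n) hstab
    have hIq : ∀ a ∈ I, ∀ y : M ⧸ K n, a • y = 0 := by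
      intro a ha y
      obtain ⟨y, rfl⟩ := (K n).mkQ_surjective y
      rw [← map_smul, hI a ha, map_zero]
    have hreg : ∀ z : M ⧸ K n, x l • z = 0 → z = 0 := by
      intro z hz
      obtain ⟨z, rfl⟩ := (K n).mkQ_surjective z
      rw [← map_smul, Submodule.mkQ_apply, Submodule.Quotient.mk_eq_zero, hmemK, smul_smul,
        ← pow_succ, ← hmemK, ← hn (n + 1) n.le_succ] at hz
      rwa [Submodule.mkQ_apply, Submodule.Quotient.mk_eq_zero]
    have hnotin : x l ^ n ∉ I := fun h => hl (hprime.mem_of_pow_mem n h)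
    have BA := ih _ (hlt hnotin) (hhom hxn) _ _ _ (P.submodule (K n) hstab)
      (smul_eq_zero_of_mem_sup (fun a ha z => Subtype.ext (hI a ha z))
        (fun z => Subtype.ext z.2))
    refine bounded_of_exact (P.exact_quotient hx (K n)) (hlt hnotin).le le_rfl BA ?_
    have hstab' : ∀ j, ∀ y ∈ LinearMap.range (LinearMap.lsmul R (M ⧸ K n) (x l)),
        ϖ j y ∈ LinearMap.range (LinearMap.lsmul R (M ⧸ K n) (x l)) := by
      rintro j _ ⟨y, rfl⟩
      rw [LinearMap.lsmul_apply, Pq.smul' (hx l)]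
      exact ⟨_, rfl⟩
    obtain ⟨ϖ', Pc⟩ := Pq.quotient _ hstab'
    have BC := ih _ (hlt hl) (hhom (hx l)) _ _ _ Pc
      (smul_eq_zero_of_mem_sup (fun a ha z => by
        obtain ⟨z, rfl⟩ := Submodule.mkQ_surjective _ z
        rw [← map_smul, hIq a ha, map_zero])
        (fun z => by
          obtain ⟨z, rfl⟩ := Submodule.mkQ_surjective _ z
          rw [← map_smul, Submodule.mkQ_apply, Submodule.Quotient.mk_eq_zero]
          exact ⟨z, rfl⟩))
    have E := Pq.exact_smul hx (hx l) hreg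
    have step : ∀ p j : ℤ, (∀ j', j ≤ j' → Van x (fun j => ((ℳ j).map
          (K n).mkQ.toAddMonoidHom).map (LinearMap.range
          (LinearMap.lsmul R (M ⧸ K n) (x l))).mkQ.toAddMonoidHom) (p - 1) j') →
        Van x (fun j => (ℳ j).map (K n).mkQ.toAddMonoidHom) p j := by
      intro p j hC
      refine van_of_smul_exact E hC fun t ω hω hd => ⟨t, ?_⟩
      rw [Nat.cast_one, mul_one]
      exact limZero_pow_smul hω hd l
    obtain ⟨J, hJ⟩ := BC.exists_bound
    refine ⟨⟨J, fun p j hj => step p j fun j' hj' => hJ _ _ (hj.trans_le hj')⟩, ?_⟩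
    intro n' hn' p j hp
    obtain _ | n' := n'
    · have := Ideal.Quotient.nontrivial_iff.2 hprime.ne_top
      exact ((ringKrullDim_nonneg_of_nontrivial (R := R ⧸ I)).not_gt (by simpa using hn')).elim
    · refine step p j fun j' _ => BC.of_dim_lt n'
        (ringKrullDim_quotient_sup_span_lt hprime hl hn') _ _ ?_
      push_cast at hp
      omega
  · -- a product of homogeneous elements outside `I` lies in `I`
    have : ∃ a b : R, SetLike.IsHomogeneousElem 𝒜 a ∧ SetLike.IsHomogeneousElem 𝒜 b ∧
        a * b ∈ I ∧ a ∉ I ∧ b ∉ I := by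
      by_contra h
      push Not at h
      refine hprime (hIh.isPrime_of_homogeneous_mem_or_mem (fun h => hl (h ▸ trivial)) ?_)
      intro a b ha hb hab
      by_contra hc
      rw [not_or] at hc
      exact hc.2 (h a b ha hb hab hc.1)
    obtain ⟨a, b, ⟨d, ha⟩, ⟨e, hb⟩, hab, haI, hbI⟩ := this
    have hstab : ∀ j, ∀ y ∈ LinearMap.range (LinearMap.lsmul R M a),
        π j y ∈ LinearMap.range (LinearMap.lsmul R M a) := by
      rintro j _ ⟨y, rfl⟩
      rw [LinearMap.lsmul_apply, P.smul' ha]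
      exact ⟨_, rfl⟩
    obtain ⟨ϖ, Pq⟩ := P.quotient _ hstab
    refine bounded_of_exact (P.exact_quotient hx (LinearMap.range (LinearMap.lsmul R M a)))
      (hlt hbI).le (hlt haI).le
      (ih _ (hlt hbI) (hhom hb) _ _ _ (P.submodule _ hstab) ?_)
      (ih _ (hlt haI) (hhom ha) _ _ _ Pq ?_)
    · refine smul_eq_zero_of_mem_sup (fun a ha z => Subtype.ext (hI a ha z)) ?_
      rintro ⟨_, z, rfl⟩
      refine Subtype.ext ?_
      change b • a • z = 0
      rw [smul_smul, mul_comm, hI _ hab]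
    · refine smul_eq_zero_of_mem_sup (fun a ha z => ?_) fun z => ?_
      · obtain ⟨z, rfl⟩ := Submodule.mkQ_surjective _ z
        rw [← map_smul, hI a ha, map_zero]
      · obtain ⟨z, rfl⟩ := Submodule.mkQ_surjective _ z
        rw [← map_smul, Submodule.mkQ_apply, Submodule.Quotient.mk_eq_zero]
        exact ⟨z, rfl⟩

end Induction

section Ungraded

open scoped Pointwise

variable {R : Type} [CommRing R] {m : ℕ}

/-- The trivial grading, for which `Van` is vanishing of ungraded local cohomology. -/
abbrev triv (M : Type) [AddCommGroup M] : ℤ → AddSubgroup M := fun _ => ⊤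

theorem exact_triv {A B C : Type} [AddCommGroup A] [Module R A] [AddCommGroup B] [Module R B]
    [AddCommGroup C] [Module R C] (x : Fin m → R) (f : A →ₗ[R] B) (g : B →ₗ[R] C)
    (hf : Function.Injective f) (hfg : ∀ b, g b = 0 → ∃ a, f a = b) (h0 : ∀ a, g (f a) = 0)
    (hg : Function.Surjective g) : GradedExact x (triv A) (triv B) (triv C) f g where
  inj := hf
  exact := hfg
  comp := h0
  memA _ _ := ⟨fun _ => trivial, fun _ => trivial⟩
  memC _ c := ⟨fun _ => (hg c).imp fun _ h => ⟨trivial, h⟩, fun _ => trivial⟩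
  degOne _ _ _ _ := trivial

theorem exact_smul_triv {M : Type} [AddCommGroup M] [Module R M] (x : Fin m → R) {y : R}
    (hy : IsSMulRegular M y) : GradedExact x (triv M) (triv M) (triv (QuotSMulTop y M))
      (LinearMap.lsmul R M y) (Submodule.mkQ (y • (⊤ : Submodule R M))) := by
  refine exact_triv x _ _ hy ?_ ?_ (Submodule.mkQ_surjective _)
  · intro b hb
    rw [Submodule.mkQ_apply, Submodule.Quotient.mk_eq_zero] at hb
    obtain ⟨a, -, rfl⟩ := (Submodule.mem_smul_pointwise_iff_exists _ _ _).1 hb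
    exact ⟨a, rfl⟩
  · intro a
    rw [Submodule.mkQ_apply, Submodule.Quotient.mk_eq_zero]
    exact Submodule.smul_mem_pointwise_smul _ _ _ trivial

theorem exists_limZero_pow_smul {M : Type} [AddCommGroup M] [Module R M] {x : Fin m → R} {y : R}
    (hy : y ∈ Ideal.span (Set.range x)) {p j : ℤ} {t : ℕ} {ω : Finset (Fin m) → M}
    (hω : ω ∈ coch m (triv M) t p j) (hd : diff x t ω = 0) :
    ∃ n : ℕ, LimZero x (triv M) p (j + n * (0 : ℕ)) t (y ^ n • ω) := by
  let K : Ideal R :=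
    { carrier := {r | ∃ η ∈ coch m (triv M) t (p - 1) j, diff x t η = r • ω}
      zero_mem' := ⟨0, zero_mem _, by simp⟩
      add_mem' := by
        rintro a b ⟨η, hη, e⟩ ⟨η', hη', e'⟩
        exact ⟨η + η', add_mem hη hη', by rw [map_add, e, e', add_smul]⟩
      smul_mem' := by
        rintro c a ⟨η, hη, e⟩
        refine ⟨c • η, fun G => ⟨trivial, fun hG => ?_⟩, by rw [map_smul, e, smul_assoc]⟩
        rw [Pi.smul_apply, (hη G).2 hG, smul_zero] }
  have hK : Ideal.span (Set.range x) ≤ K.radical := by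
    rw [Ideal.span_le]
    rintro _ ⟨l, rfl⟩
    refine ⟨t, contract l ω, fun G => ⟨trivial, (contract_mem l hω G).2⟩, ?_⟩
    have h := diff_contract x t l ω
    have h0 : contract l (0 : Finset (Fin m) → M) = 0 := by
      funext G; simp [contract]
    rwa [hd, h0, add_zero] at h
  obtain ⟨n, η, hη, e⟩ := hK hy
  refine ⟨n, t, le_rfl, η, fun G => ⟨trivial, (hη G).2⟩, ?_⟩
  rw [e]
  funext G
  simp [trans_apply]

theorem van_of_isWeaklyRegular {x : Fin m → R} (rs : List R) :
    ∀ (M : Type) [AddCommGroup M] [Module R M], (∀ r ∈ rs, r ∈ Ideal.span (Set.range x)) →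
      RingTheory.Sequence.IsWeaklyRegular M rs →
      ∀ p : ℤ, p < rs.length → ∀ j, Van x (triv M) p j := by
  induction rs with
  | nil => intro M _ _ _ _ p hp j; exact van_of_neg _ _ (by simpa using hp) j
  | cons y rs ih =>
    intro M _ _ hrs hreg p hp j
    rw [RingTheory.Sequence.isWeaklyRegular_cons_iff] at hreg
    refine van_of_smul_exact (d := 0) (exact_smul_triv x hreg.1) (fun j' _ => ih _
      (fun r hr => hrs r (List.mem_cons_of_mem _ hr)) hreg.2 _ ?_ j') ?_
    · rw [List.length_cons] at hp
      push_cast at hp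
      omega
    · exact fun t ω hω hd => exists_limZero_pow_smul (hrs y List.mem_cons_self) hω hd

theorem eq_zero_of_van_zero {M : Type} [AddCommGroup M] [Module R M] {x : Fin m → R} {j : ℤ}
    (h : Van x (triv M) 0 j) {z : M} (hz : ∀ l, x l • z = 0) : z = 0 := by
  obtain ⟨t', -, η, hη, e⟩ := h 1 (Pi.single ∅ z) (fun G => ⟨trivial, fun hG => by
      rw [Pi.single_eq_of_ne]
      rintro rfl
      simp at hG⟩) (by
    funext G
    rw [diff_apply, Pi.zero_apply]
    refine Finset.sum_eq_zero fun i _ => ?_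
    by_cases hG : G.erase i = ∅
    · rw [hG, Pi.single_eq_same, pow_one, hz, smul_zero]
    · rw [Pi.single_eq_of_ne hG, smul_zero, smul_zero])
  rw [coch_eq_zero_of_neg (by omega) hη, map_zero] at e
  simpa [trans_apply] using (congrFun e ∅).symm

theorem le_smul_top_of_van [IsNoetherianRing R] {x : Fin m → R} (I : Ideal R) :
    ∀ (M : Type) [AddCommGroup M] [Module R M] [Module.Finite R M],
      (∀ a ∈ I, ∀ y : M, a • y = 0) → (∀ p j, Van x (triv M) p j) →
      (⊤ : Submodule R M) ≤ Ideal.span (Set.range x) • ⊤ := by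
  induction I using WellFoundedGT.induction with
  | _ I ih =>
  intro M _ _ _ hI hV
  rcases subsingleton_or_nontrivial M with hM | hM
  · intro z _
    rw [Subsingleton.elim z 0]
    exact zero_mem _
  have hy : ∃ y ∈ Ideal.span (Set.range x), IsSMulRegular M y := by
    by_contra hc
    push Not at hc
    obtain ⟨P, hP, hle⟩ := ((Ideal.span (Set.range x)).subset_union_prime_finite
      (associatedPrimes.finite R M) (f := id) 0 0 fun _ h _ _ => h.1).1 (by
        intro y hy
        simp only [id]
        rw [biUnion_associatedPrimes_eq_zero_divisors]
        by_contra h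
        refine hc y hy (isSMulRegular_iff_right_eq_zero_of_smul.2 fun z hz => ?_)
        by_contra hz0
        exact h ⟨z, hz0, hz⟩)
    rw [AssociatedPrimes.mem_iff, isAssociatedPrime_iff] at hP
    obtain ⟨hprime, z, rfl⟩ := hP
    have hz : z = 0 := eq_zero_of_van_zero (hV 0 0) fun l => by
      have := hle (Ideal.subset_span ⟨l, rfl⟩)
      simpa [Submodule.mem_colon_singleton] using this
    subst hz
    exact hprime.ne_top (by simp)
  obtain ⟨y, hy, hreg⟩ := hy
  have hyI : y ∉ I := fun h => by
    obtain ⟨z, hz⟩ := exists_ne (0 : M)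
    exact hz (isSMulRegular_iff_right_eq_zero_of_smul.1 hreg z (hI y h z))
  have E := exact_smul_triv x hreg
  have key := ih (I ⊔ Ideal.span {y})
    (lt_of_le_of_ne le_sup_left fun h => hyI (by
      rw [h]; exact Ideal.mem_sup_right (Ideal.mem_span_singleton_self y)))
    (QuotSMulTop y M)
    (smul_eq_zero_of_mem_sup (fun a ha z => by
        obtain ⟨z, rfl⟩ := Submodule.mkQ_surjective _ z
        rw [← map_smul, hI a ha, map_zero])
        (fun z => by
          obtain ⟨z, rfl⟩ := Submodule.mkQ_surjective _ z
          rw [← map_smul, Submodule.mkQ_apply, Submodule.Quotient.mk_eq_zero]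
          exact Submodule.smul_mem_pointwise_smul _ _ _ trivial))
    (fun p j => E.van_right (hV p j) (hV (p + 1) j))
  intro z _
  have hz := key (Submodule.mem_top (x := Submodule.mkQ (y • (⊤ : Submodule R M)) z))
  rw [← Submodule.range_mkQ (y • (⊤ : Submodule R M)), LinearMap.range_eq_map,
    ← Submodule.map_smul''] at hz
  obtain ⟨w, hw, e⟩ := hz
  have h1 : z - w ∈ y • (⊤ : Submodule R M) := by
    rw [← Submodule.Quotient.mk_eq_zero, ← Submodule.mkQ_apply, map_sub, e, sub_self]
  obtain ⟨v, -, hv⟩ := (Submodule.mem_smul_pointwise_iff_exists _ _ _).1 h1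
  rw [← sub_add_cancel z w, ← hv]
  exact add_mem (Submodule.smul_mem_smul hy trivial) hw

end Ungraded

section Filtration

variable {k0 R M N : Type} [Field k0] [CommRing R] [Algebra k0 R] {𝒜 : ℕ → Submodule k0 R}
  [AddCommGroup M] [Module R M] [AddCommGroup N] [Module R N] {m : ℕ}

theorem exists_isProj [Module k0 M] (ℳ : ℤ → Submodule k0 M) (hsup : iSup ℳ = ⊤)
    (hind : iSupIndep ℳ)
    (hsmul : ∀ (d : ℕ) (j : ℤ) (r : R) (y : M), r ∈ 𝒜 d → y ∈ ℳ j → r • y ∈ ℳ ((d : ℤ) + j)) :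
    ∃ π : ℤ → M → M, IsProj 𝒜 (fun j => (ℳ j).toAddSubgroup) π := by
  classical
  have hint := DirectSum.isInternal_submodule_of_iSupIndep_of_iSup_eq_top hind hsup
  let := hint.chooseDecomposition
  have hof : ∀ i j, ∀ y ∈ ℳ i, (DirectSum.decompose ℳ y j : M) = if i = j then y else 0 := by
    intro i j y hy
    split_ifs with h
    · subst h
      exact DirectSum.decompose_of_mem_same ℳ hy
    · exact DirectSum.decompose_of_mem_ne ℳ hy h
  refine ⟨fun j y => DirectSum.decompose ℳ y j, ?_, fun j y => (DirectSum.decompose ℳ y j).2,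
    hof, ?_, ?_⟩
  · intro j y z
    simp
  · intro d r hr j y
    induction y using DirectSum.Decomposition.inductionOn ℳ with
    | zero => simp
    | @homogeneous i y =>
      rw [hof _ _ _ y.2, hof _ _ _ (hsmul d i r y hr y.2)]
      by_cases h : i = j
      · rw [if_pos h, if_pos (by omega)]
      · rw [if_neg h, if_neg (by omega), smul_zero]
    | add y z hy hz => simp [smul_add, hy, hz]
  · intro y
    refine ⟨(DirectSum.decompose ℳ y).support, fun j hj => ?_, DirectSum.sum_support_decompose ℳ y⟩
    simpa using hj

theorem IsProj.map {ℳ : ℤ → AddSubgroup M} {π : ℤ → M → M} (P : IsProj 𝒜 ℳ π)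
    {𝒩 : ℤ → AddSubgroup N} {ϖ : ℤ → N → N} (Q : IsProj 𝒜 𝒩 ϖ) (f : M →ₗ[R] N)
    (hf : ∀ j, ∀ y ∈ ℳ j, f y ∈ 𝒩 j) (j : ℤ) (y : M) : ϖ j (f y) = f (π j y) := by
  obtain ⟨F, hF, e⟩ := P.sum y
  conv_lhs => rw [← e, map_sum, Q.finset_sum]
  rw [Finset.sum_congr rfl fun i _ => Q.of_mem i j _ (hf i _ (P.mem i y))]
  rw [Finset.sum_ite_eq' F j (fun i => f (π i y))]
  split_ifs with h
  · rfl
  · rw [hF j h, map_zero]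

theorem IsProj.decompose_smul [GradedAlgebra 𝒜] {ℳ : ℤ → AddSubgroup M} {π : ℤ → M → M}
    (P : IsProj 𝒜 ℳ π) (r : R) (d : ℕ) {j : ℤ} {z : M} (hz : z ∈ ℳ j) :
    (DirectSum.decompose 𝒜 r d : R) • z = π (j + d) (r • z) := by
  induction r using DirectSum.Decomposition.inductionOn 𝒜 with
  | zero => simp [P.zero]
  | @homogeneous i r =>
    rw [P.of_mem _ _ _ (P.smul_mem r.2 hz)]
    by_cases h : i = d
    · subst h
      rw [DirectSum.decompose_of_mem_same 𝒜 r.2, if_pos rfl]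
    · rw [DirectSum.decompose_of_mem_ne 𝒜 r.2 h, if_neg (by omega), zero_smul]
  | add r r' h h' => simp [add_smul, P.add, h, h']

theorem IsProj.eq_zero {ℳ : ℤ → AddSubgroup M} {π : ℤ → M → M} (P : IsProj 𝒜 ℳ π) {r : R}
    (h : ∀ j, ∀ z ∈ ℳ j, r • z = 0) (y : M) : r • y = 0 := by
  obtain ⟨F, -, e⟩ := P.sum y
  rw [← e, Finset.smul_sum]
  exact Finset.sum_eq_zero fun j _ => h j _ (P.mem j y)

theorem IsProj.isHomogeneous_annihilator [GradedAlgebra 𝒜] {ℳ : ℤ → AddSubgroup M}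
    {π : ℤ → M → M} (P : IsProj 𝒜 ℳ π) : (Module.annihilator R M).IsHomogeneous 𝒜 := by
  intro d r hr
  rw [Module.mem_annihilator] at hr ⊢
  refine P.eq_zero fun j z hz => ?_
  rw [P.decompose_smul r d hz, hr, P.zero]

theorem IsProj.subsingleton [GradedAlgebra 𝒜] [Module.Finite R M] {ℳ : ℤ → AddSubgroup M}
    {π : ℤ → M → M} (P : IsProj 𝒜 ℳ π) {x : Fin m → R} (hx : ∀ l, x l ∈ 𝒜 1)
    (h : (⊤ : Submodule R M) ≤ Ideal.span (Set.range x) • ⊤) : Subsingleton M := by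
  obtain ⟨r, hr, hr0⟩ := Submodule.exists_sub_one_mem_and_smul_eq_zero_of_fg_of_le_smul _ _
    Module.Finite.fg_top h
  have hirr : Ideal.span (Set.range x) ≤ (HomogeneousIdeal.irrelevant 𝒜).toIdeal := by
    rw [Ideal.span_le]
    rintro _ ⟨l, rfl⟩
    exact (HomogeneousIdeal.mem_irrelevant_iff 𝒜 _).2
      (DirectSum.decompose_of_mem_ne 𝒜 (hx l) one_ne_zero)
  have h0 : (DirectSum.decompose 𝒜 (r - 1) 0 : R) = 0 :=
    (HomogeneousIdeal.mem_irrelevant_iff 𝒜 _).1 (hirr hr)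
  have h1 : ∀ y : M, (1 : R) • y = 0 := P.eq_zero fun j z hz => by
    have := P.decompose_smul (r - 1) 0 hz
    rw [h0, zero_smul, sub_smul, hr0 z trivial, one_smul, zero_sub, Nat.cast_zero, add_zero,
      ← zero_sub, P.sub, P.zero, P.self hz, zero_sub, eq_comm, neg_eq_zero] at this
    rw [one_smul, this]
  exact ⟨fun a b => by rw [← one_smul R a, ← one_smul R b, h1, h1]⟩

theorem exact_of_isProj {A B C : Type} [AddCommGroup A] [Module R A] [AddCommGroup B] [Module R B]
    [AddCommGroup C] [Module R C] {ℳ₁ : ℤ → AddSubgroup A} {ℳ₂ : ℤ → AddSubgroup B}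
    {ℳ₃ : ℤ → AddSubgroup C} {π₁ : ℤ → A → A} {π₂ : ℤ → B → B} {π₃ : ℤ → C → C}
    (P₁ : IsProj 𝒜 ℳ₁ π₁) (P₂ : IsProj 𝒜 ℳ₂ π₂) (P₃ : IsProj 𝒜 ℳ₃ π₃)
    {x : Fin m → R} (hx : ∀ l, x l ∈ 𝒜 1) {f : A →ₗ[R] B} {g : B →ₗ[R] C}
    (hf : Function.Injective f) (hfg : Function.Exact f g) (hg : Function.Surjective g)
    (hfhom : ∀ j, ∀ y ∈ ℳ₁ j, f y ∈ ℳ₂ j) (hghom : ∀ j, ∀ y ∈ ℳ₂ j, g y ∈ ℳ₃ j) :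
    GradedExact x ℳ₁ ℳ₂ ℳ₃ f g where
  inj := hf
  exact b hb := (hfg b).1 hb
  comp a := (hfg _).2 ⟨a, rfl⟩
  memA j a := by
    refine ⟨hfhom j a, fun h => ?_⟩
    have := P₂.self h
    rw [P₁.map P₂ f hfhom] at this
    rw [← hf this]
    exact P₁.mem j a
  memC j c := by
    constructor
    · intro h
      obtain ⟨b, rfl⟩ := hg c
      exact ⟨π₂ j b, P₂.mem j b, by rw [← P₂.map P₃ g hghom, P₃.self h]⟩
    · rintro ⟨b, hb, rfl⟩
      exact hghom j b hb
  degOne := P₂.degOne hx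

end Filtration

section Regularity

variable {k0 R M : Type} [Field k0] [CommRing R] [AddCommGroup M] [Module R M] {m : ℕ}

theorem gradedLocalCohNE_iff [Module k0 M] {x : Fin m → R} {ℳ : ℤ → Submodule k0 M} {i : ℕ}
    {j : ℤ} :
    gradedLocalCohNE x ℳ i j ↔ ¬ Van x (fun j => (ℳ j).toAddSubgroup) i j := by
  have hcoch : ∀ t p : ℕ, ∀ ω : Finset (Fin m) → M, koszulHomog ℳ t p j ω ↔
      ω ∈ coch m (fun j => (ℳ j).toAddSubgroup) t p j := by
    intro t p ω
    refine forall_congr' fun G => ?_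
    rw [Submodule.mem_toAddSubgroup, Ne, Ne, Nat.cast_inj]
    refine and_congr_left fun h => ⟨fun hG => ?_, fun hG _ => hG⟩
    by_cases hp : G.card = p
    · exact hG hp
    · rw [h hp]
      exact zero_mem _
  have hprev : ∀ t t' : ℕ, ∀ ω : Finset (Fin m) → M, koszulHomog ℳ t i j ω →
      ((∃ η, koszulHomog ℳ t' (i - 1) j η ∧ koszulD x t' η = koszulTrans x t t' ω) ↔
        ∃ η ∈ coch m (fun j => (ℳ j).toAddSubgroup) t' ((i : ℤ) - 1) j,
          diff x t' η = trans x t t' ω) := by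
    intro t t' ω hω
    obtain _ | i := i
    · constructor
      · rintro ⟨η, hη, e⟩
        refine ⟨0, zero_mem _, ?_⟩
        rw [map_zero]
        funext G
        rw [trans_apply, Pi.zero_apply]
        by_cases hG : G.card = 0
        · rw [Finset.card_eq_zero] at hG
          subst hG
          simpa [koszulD, koszulTrans] using congrFun e ∅
        · rw [(hω G).2 hG, smul_zero]
      · rintro ⟨η, hη, e⟩
        rw [coch_eq_zero_of_neg (by simp) hη] at e
        exact ⟨0, (hcoch _ _ _).2 (zero_mem _), e⟩
    · rw [Nat.add_sub_cancel, Nat.cast_add, Nat.cast_one, add_sub_cancel_right]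
      exact exists_congr fun η => and_congr_left' (hcoch _ _ _)
  unfold gradedLocalCohNE Van LimZero
  push Not
  refine exists_congr fun t => exists_congr fun ω => ?_
  rw [← hcoch]
  refine and_congr_right fun hω => and_congr_right fun _ => forall_congr' fun t' =>
    imp_congr_right fun _ => ?_
  have := (hprev t t' ω hω).not
  push Not at this
  exact this

theorem van_of_cmRegularity_lt [Module k0 M] {x : Fin m → R} {ℳ : ℤ → Submodule k0 M} {z : ℤ}
    (h : cmRegularity x ℳ < ((z : WithTop ℤ) : WithBot (WithTop ℤ))) (p : ℤ) :
    Van x (fun j => (ℳ j).toAddSubgroup) p (z - p) := by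
  rcases lt_or_ge p 0 with hp | hp
  · exact van_of_neg _ _ hp _
  lift p to ℕ using hp
  by_contra hV
  exact h.not_ge (le_sSup ⟨z, rfl, p, gradedLocalCohNE_iff.2 hV⟩)

theorem cmRegularity_eq [Module k0 M] {x : Fin m → R} {ℳ : ℤ → Submodule k0 M} {z : ℤ} {i : ℕ}
    (hne : ¬ Van x (fun j => (ℳ j).toAddSubgroup) i (z - i))
    (hz : ∀ z', z < z' → ∀ p, Van x (fun j => (ℳ j).toAddSubgroup) p (z' - p)) :
    cmRegularity x ℳ = ((z : WithTop ℤ) : WithBot (WithTop ℤ)) := by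
  refine le_antisymm (sSup_le ?_) (le_sSup ⟨z, rfl, i, gradedLocalCohNE_iff.2 hne⟩)
  rintro _ ⟨z', rfl, i', h⟩
  rw [WithBot.coe_le_coe, WithTop.coe_le_coe]
  by_contra hlt
  exact gradedLocalCohNE_iff.1 h (hz z' (not_le.1 hlt) i')

theorem cmRegularity_eq_bot_or [Module k0 M] {x : Fin m → R} {ℳ : ℤ → Submodule k0 M} {I : Ideal R}
    (h : Bounded x I fun j => (ℳ j).toAddSubgroup) :
    cmRegularity x ℳ = ⊥ ∨ ∃ (z : ℤ) (i : ℕ),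
      cmRegularity x ℳ = ((z : WithTop ℤ) : WithBot (WithTop ℤ)) ∧
        ¬ Van x (fun j => (ℳ j).toAddSubgroup) i (z - i) := by
  by_cases hne : ∃ z : ℤ, ∃ i : ℕ, ¬ Van x (fun j => (ℳ j).toAddSubgroup) i (z - i)
  · right
    obtain ⟨J, hJ⟩ := h.exists_bound
    obtain ⟨z, ⟨i, hi⟩, hz⟩ := Int.exists_greatest_of_bdd ⟨J + m, fun z ⟨i, hi⟩ => by
      by_contra hlt
      refine hi ?_
      rcases le_or_gt i m with him | him
      · exact hJ _ _ (by omega)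
      · exact van_of_gt _ _ (by exact_mod_cast him) _⟩ hne
    refine ⟨z, i, cmRegularity_eq hi fun z' hz' p => ?_, hi⟩
    rcases lt_or_ge p 0 with hp | hp
    · exact van_of_neg _ _ hp _
    lift p to ℕ using hp
    by_contra hV
    exact (hz z' ⟨p, hV⟩).not_gt hz'
  · left
    rw [eq_bot_iff]
    refine sSup_le ?_
    rintro _ ⟨z, rfl, i, h⟩
    exact (hne ⟨z, i, gradedLocalCohNE_iff.1 h⟩).elim

end Regularity

end KoszulLimit

/-- **Lemma 5.3.**  Let `R` be a standard graded Noetherian ring over a field `k0`,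
`M` a nonzero finitely generated graded `R`-module, and
`M = M_0 ⊇ M_1 ⊇ ⋯ ⊇ M_s = 0` a finite filtration by graded submodules with graded
factors `N_i = M_i / M_{i+1}` (encoded by graded short exact sequences
`0 → M_{i+1} → M_i → N_i → 0`).  If `reg N_0 ≥ reg N_i` for every `i`, then
`reg M = reg N_0` and `depth M ≤ dim N_0`. -/
theorem regularity_of_filtration (k0 : Type) [Field k0] (R : Type) [CommRing R]
    [Algebra k0 R] [IsNoetherianRing R]
    (𝒜 : ℕ → Submodule k0 R) [GradedAlgebra 𝒜]
    (h0 : ∀ r ∈ 𝒜 0, ∃ c : k0, r = algebraMap k0 R c)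
    (𝔪 : Ideal R) (h𝔪 : 𝔪 = Ideal.span { r : R | ∃ d : ℕ, 0 < d ∧ r ∈ 𝒜 d })
    (hstd : Ideal.span ((𝒜 1 : Submodule k0 R) : Set R) = 𝔪)
    (m : ℕ) (x : Fin m → R) (hx1 : ∀ l, x l ∈ 𝒜 1)
    (hxgen : Ideal.span (Set.range x) = 𝔪)
    -- the filtration `M 0 ⊇ M 1 ⊇ ⋯ ⊇ M s = 0` with factors `N i`
    (s : ℕ) (hs : 0 < s)
    (M : ℕ → Type) [∀ i, AddCommGroup (M i)] [∀ i, Module R (M i)]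
    [∀ i, Module k0 (M i)] [∀ i, IsScalarTower k0 R (M i)] [∀ i, Module.Finite R (M i)]
    (N : ℕ → Type) [∀ i, AddCommGroup (N i)] [∀ i, Module R (N i)]
    [∀ i, Module k0 (N i)] [∀ i, IsScalarTower k0 R (N i)]
    (hM0 : Nontrivial (M 0)) (hMs : Subsingleton (M s))
    (f : ∀ i, M (i + 1) →ₗ[R] M i) (hf : ∀ i, Function.Injective (f i))
    (g : ∀ i, M i →ₗ[R] N i) (hg : ∀ i, Function.Surjective (g i))
    (hfg : ∀ i, Function.Exact (f i) (g i))
    -- the gradings of the `M i` and `N i`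
    (ℳ : ∀ i, ℤ → Submodule k0 (M i)) (𝒩 : ∀ i, ℤ → Submodule k0 (N i))
    (hMsup : ∀ i, iSup (ℳ i) = ⊤) (hMind : ∀ i, iSupIndep (ℳ i))
    (hNsup : ∀ i, iSup (𝒩 i) = ⊤) (hNind : ∀ i, iSupIndep (𝒩 i))
    (hMsmul : ∀ i (d : ℕ) (j : ℤ) (r : R) (y : M i),
      r ∈ 𝒜 d → y ∈ ℳ i j → r • y ∈ ℳ i ((d : ℤ) + j))
    (hNsmul : ∀ i (d : ℕ) (j : ℤ) (r : R) (y : N i),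
      r ∈ 𝒜 d → y ∈ 𝒩 i j → r • y ∈ 𝒩 i ((d : ℤ) + j))
    (hfhom : ∀ i (j : ℤ), ∀ y ∈ ℳ (i + 1) j, f i y ∈ ℳ i j)
    (hghom : ∀ i (j : ℤ), ∀ y ∈ ℳ i j, g i y ∈ 𝒩 i j)
    -- hypothesis: `reg N_0 ≥ reg N_i` for every `i`
    (hreg : ∀ i < s, cmRegularity x (𝒩 i) ≤ cmRegularity x (𝒩 0)) :
    -- conclusion: `reg M = reg N_0` and `depth M ≤ dim N_0`
    cmRegularity x (ℳ 0) = cmRegularity x (𝒩 0) ∧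
    ∀ rs : List R, (∀ r ∈ rs, r ∈ 𝔪) → RingTheory.Sequence.IsRegular (M 0) rs →
      (rs.length : WithBot (WithTop ℕ)) ≤
        ringKrullDim (R ⧸ Module.annihilator R (N 0)) := by
  classical
  choose πM PM using fun i => KoszulLimit.exists_isProj (𝒜 := 𝒜) (ℳ i) (hMsup i) (hMind i)
    (hMsmul i)
  choose πN PN using fun i => KoszulLimit.exists_isProj (𝒜 := 𝒜) (𝒩 i) (hNsup i) (hNind i)
    (hNsmul i)
  have E := fun i => KoszulLimit.exact_of_isProj (PM (i + 1)) (PM i) (PN i) hx1 (hf i) (hfg i)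
    (hg i) (hfhom i) (hghom i)
  have hfinite : Module.Finite R (N 0) := Module.Finite.of_surjective (g 0) (hg 0)
  have hpos : ∀ d, 0 < d → ∀ r ∈ 𝒜 d, r ∈ Ideal.span (Set.range x) := fun d hd r hr => by
    rw [hxgen, h𝔪]
    exact Ideal.subset_span ⟨d, hd, hr⟩
  have B := KoszulLimit.bounded_of_homogeneous hx1 hpos _ (PN 0).isHomogeneous_annihilator _ _ _
    (PN 0) fun a ha => Module.mem_annihilator.1 ha
  have hvan : ∀ z : ℤ, cmRegularity x (𝒩 0) < ((z : WithTop ℤ) : WithBot (WithTop ℤ)) →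
      ∀ i ≤ s, ∀ p, KoszulLimit.Van x (fun j => (ℳ i j).toAddSubgroup) p (z - p) := by
    intro z hz i hi p
    induction hi using Nat.decreasingInduction with
    | self => exact KoszulLimit.van_of_subsingleton _ _ _ _
    | @of_succ i hi ih =>
      exact (E i).van_middle ih
        (KoszulLimit.van_of_cmRegularity_lt ((hreg i hi).trans_lt hz) p)
  rcases KoszulLimit.cmRegularity_eq_bot_or B with hbot | ⟨z, i, hz, hne⟩
  · have hV : ∀ p j, KoszulLimit.Van x (fun j => (ℳ 0 j).toAddSubgroup) p j := fun p j => by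
      simpa using hvan (j + p) (by rw [hbot]; exact WithBot.bot_lt_coe _) 0 hs.le p
    have hsub := (PM 0).subsingleton hx1 (KoszulLimit.le_smul_top_of_van ⊥ _
      (fun a ha y => by rw [Ideal.mem_bot.1 ha, zero_smul])
      fun p => KoszulLimit.van_top_of_van (PM 0) hx1 (hV p))
    exact (not_subsingleton (M 0) hsub).elim
  · have hlt : ∀ z', z < z' → cmRegularity x (𝒩 0) < ((z' : WithTop ℤ) : WithBot (WithTop ℤ)) :=
      fun z' h => by
        rw [hz, WithBot.coe_lt_coe, WithTop.coe_lt_coe]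
        exact h
    have hneM : ¬ KoszulLimit.Van x (fun j => (ℳ 0 j).toAddSubgroup) i (z - i) := fun h =>
      hne ((E 0).van_right h (by
        convert hvan (z + 1) (hlt _ (lt_add_one z)) 1 hs (i + 1) using 1
        ring))
    refine ⟨(KoszulLimit.cmRegularity_eq hneM fun z' h => hvan z' (hlt z' h) 0 hs.le).trans hz.symm,
      fun rs hrs hrsreg => ?_⟩
    have hlen : rs.length ≤ i := by
      by_contra h
      exact hneM (KoszulLimit.van_of_van_top (PM 0) hx1
        (KoszulLimit.van_of_isWeaklyRegular rs _ (fun r hr => hxgen ▸ hrs r hr)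
          hrsreg.toIsWeaklyRegular i (by exact_mod_cast not_le.1 h) _))
    have hdim : ((i : ℕ) : WithBot (WithTop ℕ)) ≤
        ringKrullDim (R ⧸ Module.annihilator R (N 0)) := by
      by_contra h
      exact hne (B.of_dim_lt i (not_le.1 h) _ _ le_rfl)
    exact le_trans (by exact_mod_cast hlen) hdim
end

section
/- Let a be an eligible k-tuple with k < ℓ − 1 and set N(a) = (a_1, ..., a_k, f(a)). Then: (a) N(a) is an eligible (k+1)-tuple, a > N(a), and a and N(a) are nearest neighbors, i.e., any eligible tuple b with a ≥ b ≥ N(a) satisfies b = a or b = N(a); (b) if r(a) = σ_{k+1}, then f(N(a)) = 0 and r(N(a)) = σ_{k+2}. -/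
/-- `σ` extended to all of `ℕ` (0-indexed positions, junk value `0` out of range);
`sigE σ u` is the paper's `σ_{u+1}`. -/
def sigE {ℓ : ℕ} (σ : Fin ℓ → ℕ) (u : ℕ) : ℕ := if h : u < ℓ then σ ⟨u, h⟩ else 0

/-- For a `k`-tuple `a` (encoded as a list of length `k`), `tupSum σ a = ∑ a_u σ_u`. -/
def tupSum {ℓ : ℕ} (σ : Fin ℓ → ℕ) (a : List ℕ) : ℕ :=
  ∑ u ∈ Finset.range a.length, a.getD u 0 * sigE σ u

/-- `a` is an eligible tuple: it has length `k` with `0 ≤ k ≤ ℓ - 1` and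
`∑ a_u σ_u < n`. -/
def Eligible {ℓ : ℕ} (σ : Fin ℓ → ℕ) (n : ℕ) (a : List ℕ) : Prop :=
  a.length < ℓ ∧ tupSum σ a < n

/-- `f(a)`, the unique non-negative integer with
`∑ a_u σ_u + f(a) σ_{k+1} < n ≤ ∑ a_u σ_u + (f(a)+1) σ_{k+1}` (here computed by the
formula `f(a) = ⌊(n - ∑ a_u σ_u - 1)/σ_{k+1}⌋`, which satisfies these inequalities
whenever `a` is eligible). -/
def tupF {ℓ : ℕ} (σ : Fin ℓ → ℕ) (n : ℕ) (a : List ℕ) : ℕ :=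
  (n - tupSum σ a - 1) / sigE σ a.length

/-- `r(a) = ∑ a_u σ_u + (f(a)+1) σ_{k+1} - n + 1`. -/
def tupR {ℓ : ℕ} (σ : Fin ℓ → ℕ) (n : ℕ) (a : List ℕ) : ℕ :=
  tupSum σ a + (tupF σ n a + 1) * sigE σ a.length + 1 - n

/-- The entries of a tuple, padded on the right by `∞`. -/
def tupPad (a : List ℕ) (i : ℕ) : ℕ∞ :=
  if h : i < a.length then (a.get ⟨i, h⟩ : ℕ∞) else ⊤

/-- The total order on eligible tuples: `b > a` iff at the first position where the
`∞`-padded tuples differ, the entry of `b` is larger.  (This combines rules (a) and (b)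
of Definition 3.1.1.) -/
def tupGT (b a : List ℕ) : Prop :=
  ∃ i, tupPad a i < tupPad b i ∧ ∀ s < i, tupPad b s = tupPad a s

theorem tupPad_of_lt {a : List ℕ} {i : ℕ} (h : i < a.length) :
    tupPad a i = (a.getD i 0 : ℕ∞) := by
  simp [tupPad, h]

theorem tupPad_of_le {a : List ℕ} {i : ℕ} (h : a.length ≤ i) : tupPad a i = ⊤ := by
  simp [tupPad, h]

theorem tupPad_lt_top_iff {a : List ℕ} {i : ℕ} : tupPad a i < ⊤ ↔ i < a.length := by
  by_cases h : i < a.length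
  · simp [tupPad, h]
  · simp [tupPad, h]

theorem tupPad_append_of_lt {a : List ℕ} (c : List ℕ) {i : ℕ} (h : i < a.length) :
    tupPad (a ++ c) i = tupPad a i := by
  have h' : i < (a ++ c).length := by simp; omega
  rw [tupPad_of_lt h, tupPad_of_lt h', List.getD_append _ _ _ _ h]

theorem tupPad_append_singleton_length (a : List ℕ) (x : ℕ) :
    tupPad (a ++ [x]) a.length = x := by
  simp [tupPad]

theorem tupGT_append_singleton (a : List ℕ) (x : ℕ) : tupGT a (a ++ [x]) := by
  refine ⟨a.length, ?_, fun s hs => (tupPad_append_of_lt [x] hs).symm⟩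
  rw [tupPad_append_singleton_length, tupPad_of_le le_rfl]
  exact ENat.natCast_lt_top x

theorem tupSum_append_singleton {ℓ : ℕ} (σ : Fin ℓ → ℕ) (a : List ℕ) (x : ℕ) :
    tupSum σ (a ++ [x]) = tupSum σ a + x * sigE σ a.length := by
  unfold tupSum
  rw [List.length_append, List.length_singleton, Finset.sum_range_succ]
  congr 1
  · refine Finset.sum_congr rfl fun u hu => ?_
    rw [List.getD_append _ _ _ _ (Finset.mem_range.mp hu)]
  · simp

/-- A tuple that properly extends `a` has at least the sum of `a` with one more entry. -/
theorem tupSum_add_le {ℓ : ℕ} (σ : Fin ℓ → ℕ) {a b : List ℕ} (hlen : a.length < b.length)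
    (h : ∀ s < a.length, tupPad a s = tupPad b s) :
    tupSum σ a + b.getD a.length 0 * sigE σ a.length ≤ tupSum σ b := by
  have hsum : tupSum σ a = ∑ u ∈ Finset.range a.length, b.getD u 0 * sigE σ u := by
    refine Finset.sum_congr rfl fun u hu => ?_
    have hu' := Finset.mem_range.mp hu
    have hpad := h u hu'
    rw [tupPad_of_lt hu', tupPad_of_lt (hu'.trans hlen), Nat.cast_inj] at hpad
    rw [hpad]
  rw [hsum, ← Finset.sum_range_succ (fun u => b.getD u 0 * sigE σ u)]
  exact Finset.sum_le_sum_of_subset (Finset.range_mono hlen)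

theorem sigE_pos {ℓ : ℕ} {σ : Fin ℓ → ℕ} (hσ1 : ∀ i, 1 ≤ σ i) {u : ℕ} (hu : u < ℓ) :
    0 < sigE σ u := by
  rw [sigE, dif_pos hu]
  exact hσ1 ⟨u, hu⟩

theorem tupSum_add_tupF_mul_lt {ℓ : ℕ} {σ : Fin ℓ → ℕ} {n : ℕ} {a : List ℕ}
    (ha : Eligible σ n a) : tupSum σ a + tupF σ n a * sigE σ a.length < n := by
  have h1 := Nat.div_mul_le_self (n - tupSum σ a - 1) (sigE σ a.length)
  have h2 := ha.2
  unfold tupF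
  omega

theorem le_tupSum_add_succ_tupF_mul {ℓ : ℕ} {σ : Fin ℓ → ℕ} (hσ1 : ∀ i, 1 ≤ σ i) {n : ℕ}
    {a : List ℕ} (ha : Eligible σ n a) :
    n ≤ tupSum σ a + (tupF σ n a + 1) * sigE σ a.length := by
  have h1 := Nat.lt_mul_div_succ (n - tupSum σ a - 1) (sigE_pos hσ1 ha.1)
  unfold tupF
  rw [mul_comm]
  omega

/-- A tuple strictly between `a` and `a ++ [x]` properly extends `a`, with next entry above `x`. -/
theorem length_lt_and_tupPad_eq_of_tupGT {a b : List ℕ} {x : ℕ} (hab : tupGT a b)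
    (hb : tupGT b (a ++ [x])) :
    a.length < b.length ∧ (∀ s < a.length, tupPad a s = tupPad b s) ∧
      tupPad (a ++ [x]) a.length < tupPad b a.length := by
  obtain ⟨i, hi, hi'⟩ := hab
  obtain ⟨j, hj, hj'⟩ := hb
  have hai : a.length ≤ i := by
    by_contra! hlt
    rcases lt_trichotomy j i with h | rfl | h
    · rw [tupPad_append_of_lt [x] (h.trans hlt), hi' j h] at hj
      exact hj.false
    · rw [tupPad_append_of_lt [x] hlt] at hj
      exact hj.not_gt hi
    · have := hj' i h
      rw [tupPad_append_of_lt [x] hlt] at this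
      exact hi.ne this
  have hib : i < b.length := tupPad_lt_top_iff.mp (hi.trans_le le_top)
  have hjN : j < a.length + 1 := by
    simpa using tupPad_lt_top_iff.mp (hj.trans_le le_top)
  have hja : j = a.length := by
    by_contra hne
    have hlt : j < a.length := by omega
    rw [tupPad_append_of_lt [x] hlt, hi' j (hlt.trans_le hai)] at hj
    exact hj.false
  exact ⟨hai.trans_lt hib, fun s hs => hi' s (hs.trans_le hai), hja ▸ hj⟩

/-- **Lemma 6.2.** Let `a` be an eligible `k`-tuple with `k < ℓ - 1`, and let
`N(a) = (a_1, …, a_k, f(a))`.  Then: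
(a) `N(a)` is an eligible `(k+1)`-tuple, `a > N(a)`, and `a`, `N(a)` are nearest
neighbors: any eligible `b` with `a ≥ b ≥ N(a)` satisfies `b = a` or `b = N(a)`;
(b) if `r(a) = σ_{k+1}`, then `f(N(a)) = 0` and `r(N(a)) = σ_{k+2}`. -/
theorem eligible_succ_nearest_neighbor {ℓ : ℕ} (hℓ : 2 ≤ ℓ) (σ : Fin ℓ → ℕ)
    (hσ : Antitone σ) (hσ1 : ∀ i, 1 ≤ σ i) (n : ℕ) (hn : 2 ≤ n)
    (a : List ℕ) (ha : Eligible σ n a) (hlen : a.length + 1 < ℓ) :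
    (Eligible σ n (a ++ [tupF σ n a]) ∧
      tupGT a (a ++ [tupF σ n a]) ∧
      ∀ b : List ℕ, Eligible σ n b →
        (tupGT a b ∨ a = b) → (tupGT b (a ++ [tupF σ n a]) ∨ b = a ++ [tupF σ n a]) →
        b = a ∨ b = a ++ [tupF σ n a]) ∧
    (tupR σ n a = sigE σ a.length →
      tupF σ n (a ++ [tupF σ n a]) = 0 ∧
      tupR σ n (a ++ [tupF σ n a]) = sigE σ (a.length + 1)) := by
  have hlt := tupSum_add_tupF_mul_lt ha
  have hle := le_tupSum_add_succ_tupF_mul hσ1 ha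
  have hsum := tupSum_append_singleton σ a (tupF σ n a)
  refine ⟨⟨⟨by simpa using hlen, hsum ▸ hlt⟩, tupGT_append_singleton a _, ?_⟩, fun hr => ?_⟩
  · rintro b hb (hab | rfl) hbN
    · rcases hbN with hbN | rfl
      · exfalso
        obtain ⟨hlen', hpad, hf⟩ := length_lt_and_tupPad_eq_of_tupGT hab hbN
        rw [tupPad_append_singleton_length, tupPad_of_lt hlen', Nat.cast_lt] at hf
        have h1 := tupSum_add_le σ hlen' hpad
        have h2 := Nat.mul_le_mul_right (sigE σ a.length) (Nat.succ_le_of_lt hf)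
        have h3 := hb.2
        simp only [Nat.succ_eq_add_one] at h2
        omega
      · exact Or.inr rfl
    · exact Or.inl rfl
  · have hn1 : tupSum σ (a ++ [tupF σ n a]) + 1 = n := by
      unfold tupR at hr
      rw [add_mul, one_mul] at hr hle
      omega
    have hf0 : tupF σ n (a ++ [tupF σ n a]) = 0 := by
      have hsub : n - tupSum σ (a ++ [tupF σ n a]) - 1 = 0 := by omega
      rw [tupF, hsub, Nat.zero_div]
    refine ⟨hf0, ?_⟩
    rw [tupR, hf0, List.length_append, List.length_singleton]
    omega
end
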